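/- Stability of the L^p-Poincaré inequality (Theorem 3.2 / (1.6)): Let p ≥ 2, n ≥ 2, and let Ω ⊂ ℝⁿ be an open bounded convex set with smooth boundary, of diameter diam(Ω). Let u₁ be a first Dirichlet eigenfunction of the p-Laplacian on Ω (positive in Ω; by Sakaguchi's theorem log u₁ is concave). Then for every real-valued smooth function u with compact support in Ω: ∫_Ω |∇u|^p dx − λ₁(p,Ω) ∫_Ω |u|^p dx ≥ 2^{2−p} (π_p / diam(Ω))^p · inf_{c∈ℝ} ∫_Ω |u − c·u₁|^p dx. -/

import Mathlib

open MeasureTheory Real Filter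
open scoped RealInnerProductSpace

/-- `π_p = 2π (p-1)^{1/p} / (p sin(π/p))`. -/
noncomputable def piP (p : ℝ) : ℝ :=
  2 * Real.pi * (p - 1) ^ (1 / p) / (p * Real.sin (Real.pi / p))

/-- The first Dirichlet eigenvalue of the `p`-Laplacian on `Ω`, defined as the infimum of the
Rayleigh quotients over smooth nontrivial functions compactly supported in `Ω`. -/
noncomputable def lambda1 (n : ℕ) (p : ℝ) (Ω : Set (EuclideanSpace ℝ (Fin n))) : ℝ :=
  sInf { r : ℝ | ∃ u : EuclideanSpace ℝ (Fin n) → ℝ,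
    ContDiff ℝ (⊤ : ℕ∞) u ∧ HasCompactSupport u ∧ tsupport u ⊆ Ω ∧ u ≠ 0 ∧
    r = (∫ x in Ω, ‖gradient u x‖ ^ p) / (∫ x in Ω, |u x| ^ p) }

section VectorInequality

lemma rpow_add_le_two_rpow_mul {a b q : ℝ} (ha : 0 ≤ a) (hb : 0 ≤ b) (hq : 1 ≤ q) :
    (a + b) ^ q ≤ 2 ^ (q - 1) * (a ^ q + b ^ q) := by
  have h := NNReal.rpow_add_le_mul_rpow_add_rpow ⟨a, ha⟩ ⟨b, hb⟩ hq
  exact_mod_cast h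

lemma rpow_sub_one_mul_self {a p : ℝ} (ha : 0 ≤ a) (hp : p ≠ 0) : a ^ (p - 1) * a = a ^ p := by
  rw [← Real.rpow_add_one' ha (by simpa using hp), sub_add_cancel]

lemma rpow_sub_two_mul_sq {a p : ℝ} (ha : 0 ≤ a) (hp : p ≠ 0) : a ^ (p - 2) * a ^ 2 = a ^ p := by
  rw [← Real.rpow_natCast, ← Real.rpow_add' ha (by simpa using hp)]; norm_num

lemma rpow_sub_two_mul_self {a p : ℝ} (ha : 0 ≤ a) (hp : p ≠ 1) :
    a ^ (p - 2) * a = a ^ (p - 1) := by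
  rw [← Real.rpow_add_one' ha (by contrapose! hp; linarith)]; ring_nf

/-- The scalar inequality behind strong monotonicity when the two vectors are antiparallel. -/
lemma two_rpow_mul_add_rpow_le {p α β : ℝ} (hp : 2 ≤ p) (hα : 0 ≤ α) (hβ : 0 ≤ β) :
    2 ^ (2 - p) * (α + β) ^ p ≤ (α ^ (p - 1) + β ^ (p - 1)) * (α + β) := by
  have h := rpow_add_le_two_rpow_mul hα hβ (by linarith : (1:ℝ) ≤ p - 1)
  rw [← rpow_sub_one_mul_self (add_nonneg hα hβ) (by linarith : p ≠ 0), ← mul_assoc]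
  refine mul_le_mul_of_nonneg_right ?_ (add_nonneg hα hβ)
  calc (2:ℝ) ^ (2 - p) * (α + β) ^ (p - 1)
      ≤ 2 ^ (2 - p) * (2 ^ (p - 1 - 1) * (α ^ (p - 1) + β ^ (p - 1))) := by gcongr
    _ = α ^ (p - 1) + β ^ (p - 1) := by
      rw [← mul_assoc, ← Real.rpow_add two_pos]; ring_nf; simp

/-- The scalar inequality behind strong monotonicity when the two vectors are parallel. -/
lemma two_rpow_mul_abs_sub_rpow_le {p α β : ℝ} (hp : 2 ≤ p) (hα : 0 ≤ α) (hβ : 0 ≤ β) :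
    2 ^ (2 - p) * |α - β| ^ p ≤ (α ^ (p - 1) - β ^ (p - 1)) * (α - β) := by
  wlog h : β ≤ α generalizing α β
  · have := this hβ hα (le_of_not_ge h)
    rw [abs_sub_comm]; linarith
  have h0 : 0 ≤ α - β := sub_nonneg.2 h
  have h1 := Real.add_rpow_le_rpow_add h0 hβ (by linarith : (1:ℝ) ≤ p - 1)
  rw [sub_add_cancel] at h1
  have h2 : (2:ℝ) ^ (2 - p) ≤ 1 := Real.rpow_le_one_of_one_le_of_nonpos (by norm_num) (by linarith)
  rw [abs_of_nonneg h0, ← rpow_sub_one_mul_self h0 (by linarith : p ≠ 0), ← mul_assoc]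
  refine mul_le_mul_of_nonneg_right ?_ h0
  have : 0 ≤ (α - β) ^ (p - 1) := Real.rpow_nonneg h0 _
  nlinarith

variable {F : Type*} [NormedAddCommGroup F] [InnerProductSpace ℝ F]

/-- Strong monotonicity of `x ↦ ‖x‖ ^ (p - 2) • x`, with the optimal constant. -/
lemma two_rpow_mul_norm_sub_rpow_le {p : ℝ} (hp : 2 ≤ p) (x y : F) :
    2 ^ (2 - p) * ‖x - y‖ ^ p
      ≤ ‖x‖ ^ (p - 2) * ⟪x, x - y⟫ - ‖y‖ ^ (p - 2) * ⟪y, x - y⟫ := by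
  set α := ‖x‖ with hα
  set β := ‖y‖ with hβ
  have hα0 : 0 ≤ α := norm_nonneg x
  have hβ0 : 0 ≤ β := norm_nonneg y
  obtain ⟨θ, hθ0, hθ1, hθ⟩ : ∃ θ : ℝ, 0 ≤ θ ∧ θ ≤ 1 ∧ ⟪x, y⟫ = (2 * θ - 1) * (α * β) := by
    have h := abs_le.1 (abs_real_inner_le_norm x y)
    rcases (mul_nonneg hα0 hβ0).eq_or_lt with h0 | h0
    · refine ⟨1, zero_le_one, le_rfl, ?_⟩
      rw [← h0] at h ⊢; linarith [h.1, h.2]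
    · refine ⟨(⟪x, y⟫ / (α * β) + 1) / 2, ?_, ?_, ?_⟩
      · have : -1 ≤ ⟪x, y⟫ / (α * β) := by rw [le_div_iff₀ h0]; linarith [h.1]
        linarith
      · have : ⟪x, y⟫ / (α * β) ≤ 1 := by rw [div_le_iff₀ h0]; linarith [h.2]
        linarith
      · have : α * β ≠ 0 := h0.ne'
        rw [mul_div_cancel₀ _ two_ne_zero, add_sub_cancel_right, div_mul_cancel₀ _ this]
  have hsq : ‖x - y‖ ^ 2 = (1 - θ) * (α + β) ^ 2 + θ * |α - β| ^ 2 := by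
    rw [norm_sub_sq_real, hθ, sq_abs]; ring
  have hpow : ∀ a : ℝ, 0 ≤ a → a ^ p = (a ^ 2) ^ (p / 2) := fun a ha => by
    rw [← Real.rpow_natCast, ← Real.rpow_mul ha]; congr 1; push_cast; ring
  have hconv : ‖x - y‖ ^ p ≤ (1 - θ) * (α + β) ^ p + θ * |α - β| ^ p := by
    rw [hpow _ (norm_nonneg _), hsq, hpow _ (add_nonneg hα0 hβ0), hpow _ (abs_nonneg _)]
    have := (convexOn_rpow (by linarith : (1:ℝ) ≤ p / 2)).2
      (x := (α + β) ^ 2) (y := |α - β| ^ 2) (Set.mem_Ici.2 (sq_nonneg (α + β)))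
      (Set.mem_Ici.2 (sq_nonneg |α - β|))
      (sub_nonneg.2 hθ1) hθ0 (by ring)
    simpa only [smul_eq_mul] using this
  have hR : ‖x‖ ^ (p - 2) * ⟪x, x - y⟫ - ‖y‖ ^ (p - 2) * ⟪y, x - y⟫
      = (1 - θ) * ((α ^ (p - 1) + β ^ (p - 1)) * (α + β))
        + θ * ((α ^ (p - 1) - β ^ (p - 1)) * (α - β)) := by
    rw [inner_sub_right, inner_sub_right, real_inner_self_eq_norm_sq, real_inner_self_eq_norm_sq,
      real_inner_comm x y, hθ, ← rpow_sub_two_mul_self hα0 (by linarith : p ≠ 1),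
      ← rpow_sub_two_mul_self hβ0 (by linarith : p ≠ 1), ← hα, ← hβ]
    ring
  rw [hR]
  calc 2 ^ (2 - p) * ‖x - y‖ ^ p
      ≤ 2 ^ (2 - p) * ((1 - θ) * (α + β) ^ p + θ * |α - β| ^ p) := by gcongr
    _ = (1 - θ) * (2 ^ (2 - p) * (α + β) ^ p) + θ * (2 ^ (2 - p) * |α - β| ^ p) := by ring
    _ ≤ _ := add_le_add
      (mul_le_mul_of_nonneg_left (two_rpow_mul_add_rpow_le hp hα0 hβ0) (sub_nonneg.2 hθ1))
      (mul_le_mul_of_nonneg_left (two_rpow_mul_abs_sub_rpow_le hp hα0 hβ0) hθ0)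

/-- Uniform convexity of `‖·‖ ^ p` for `p ≥ 2`, in first order form. -/
lemma norm_rpow_add_le_norm_add_rpow {p : ℝ} (hp : 2 ≤ p) (b η : F) :
    ‖b‖ ^ p + p * (‖b‖ ^ (p - 2) * ⟪b, η⟫) + 2 ^ (2 - p) * ‖η‖ ^ p ≤ ‖b + η‖ ^ p := by
  have hp0 : 0 < p := by linarith
  let f : ℝ → ℝ := fun t =>
    ‖b + t • η‖ ^ p - t * (p * (‖b‖ ^ (p - 2) * ⟪b, η⟫)) - 2 ^ (2 - p) * ‖η‖ ^ p * t ^ p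
  let f' : ℝ → ℝ := fun t => p * ‖b + t • η‖ ^ (p - 2) * ⟪b + t • η, η⟫
    - p * (‖b‖ ^ (p - 2) * ⟪b, η⟫) - 2 ^ (2 - p) * ‖η‖ ^ p * (p * t ^ (p - 1))
  have hf : ∀ t, HasDerivAt f (f' t) t := by
    intro t
    have h1 : HasDerivAt (fun t : ℝ => b + t • η) η t := by
      simpa using ((hasDerivAt_id t).smul_const η).const_add b
    have h2 := (hasFDerivAt_norm_rpow (b + t • η) (by linarith : 1 < p)).comp_hasDerivAt t h1
    have h3 := Real.hasDerivAt_rpow_const (x := t) (p := p) (Or.inr (by linarith))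
    have h4 := (h2.sub ((hasDerivAt_id t).mul_const (p * (‖b‖ ^ (p - 2) * ⟪b, η⟫)))).sub
      (h3.const_mul (2 ^ (2 - p) * ‖η‖ ^ p))
    refine HasDerivAt.congr_deriv h4 ?_
    simp only [f', one_mul]
    rfl
  have hmono : MonotoneOn f (Set.Icc 0 1) := by
    refine monotoneOn_of_hasDerivWithinAt_nonneg (convex_Icc _ _)
      (fun t _ => (hf t).continuousAt.continuousWithinAt)
      (f' := f') (fun t _ => (hf t).hasDerivWithinAt) ?_
    intro t ht
    rw [interior_Icc] at ht
    have ht0 : 0 < t := ht.1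
    have h := two_rpow_mul_norm_sub_rpow_le hp (b + t • η) b
    rw [add_sub_cancel_left, norm_smul, inner_smul_right, inner_smul_right,
      Real.norm_of_nonneg ht0.le, Real.mul_rpow ht0.le (norm_nonneg _),
      ← rpow_sub_one_mul_self ht0.le hp0.ne'] at h
    have h5 : 2 ^ (2 - p) * (t ^ (p - 1) * ‖η‖ ^ p)
        ≤ ‖b + t • η‖ ^ (p - 2) * ⟪b + t • η, η⟫ - ‖b‖ ^ (p - 2) * ⟪b, η⟫ := by
      refine le_of_mul_le_mul_right ?_ ht0
      linarith
    have := mul_le_mul_of_nonneg_left h5 hp0.le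
    simp only [f']
    linarith
  have h01 := hmono (Set.left_mem_Icc.2 zero_le_one) (Set.right_mem_Icc.2 zero_le_one) zero_le_one
  simp only [f, zero_smul, add_zero, one_smul, Real.zero_rpow hp0.ne', Real.one_rpow] at h01
  linarith

end VectorInequality

section PiIntegral

open scoped Topology

lemma lintegral_Ioi_one_div_add_mul_rpow {μ κ q : ℝ} (hμ : 0 < μ) (hκ : 0 < κ) (hq : 1 < q) :
    ∫⁻ z in Set.Ioi (0:ℝ), ENNReal.ofReal (1 / (μ + κ * z ^ q))
      = ENNReal.ofReal (κ ^ (-1 / q) * Real.Gamma (1 / q + 1)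
          * ((1 / μ) ^ (1 - 1 / q) * Real.Gamma (1 - 1 / q))) := by
  have hq0 : 0 < q := by linarith
  have hq1 : 0 < 1 - 1 / q := by
    have : 1 / q < 1 := by rw [div_lt_one hq0]; exact hq
    linarith
  have h1 : ∀ z ∈ Set.Ioi (0:ℝ), ENNReal.ofReal (1 / (μ + κ * z ^ q))
      = ∫⁻ x in Set.Ioi (0:ℝ), ENNReal.ofReal (Real.exp (-(μ + κ * z ^ q) * x)) := by
    intro z hz
    have hpos : 0 < μ + κ * z ^ q := by
      have := Real.rpow_nonneg (le_of_lt (Set.mem_Ioi.1 hz)) q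
      positivity
    rw [← ofReal_integral_eq_lintegral_ofReal]
    · rw [integral_exp_mul_Ioi (by linarith), mul_zero, Real.exp_zero, neg_div_neg_eq]
    · exact (integrableOn_exp_mul_Ioi (by linarith) 0)
    · exact Eventually.of_forall fun x => (Real.exp_pos _).le
  have h2 : ∀ x ∈ Set.Ioi (0:ℝ),
      ∫⁻ z in Set.Ioi (0:ℝ), ENNReal.ofReal (Real.exp (-(μ + κ * z ^ q) * x))
      = ENNReal.ofReal (κ ^ (-1 / q) * Real.Gamma (1 / q + 1)
          * (x ^ (1 - 1 / q - 1) * Real.exp (-(μ * x)))) := by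
    intro x hx
    have hx : 0 < x := hx
    have hb : 0 < κ * x := mul_pos hκ hx
    have hGpos : 0 < Real.Gamma (1 / q + 1) := Real.Gamma_pos_of_pos (by positivity)
    have hI : ∫ z in Set.Ioi (0:ℝ), Real.exp (-(μ + κ * z ^ q) * x)
        = κ ^ (-1 / q) * Real.Gamma (1 / q + 1)
          * (x ^ (1 - 1 / q - 1) * Real.exp (-(μ * x))) := by
      have : ∀ z : ℝ, Real.exp (-(μ + κ * z ^ q) * x)
          = Real.exp (-(μ * x)) * Real.exp (-(κ * x) * z ^ q) := fun z => by
        rw [← Real.exp_add]; congr 1; ring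
      simp_rw [this]
      rw [integral_const_mul, integral_exp_neg_mul_rpow hq0 hb, Real.mul_rpow hκ.le hx.le]
      rw [show (1 - 1 / q - 1) = -1 / q by ring]
      ring
    rw [← hI, ofReal_integral_eq_lintegral_ofReal]
    · by_contra hni
      rw [integral_undef hni] at hI
      have : 0 < κ ^ (-1 / q) * Real.Gamma (1 / q + 1)
          * (x ^ (1 - 1 / q - 1) * Real.exp (-(μ * x))) := by positivity
      linarith
    · exact Eventually.of_forall fun x => (Real.exp_pos _).le
  rw [setLIntegral_congr_fun measurableSet_Ioi h1, lintegral_lintegral_swap,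
    setLIntegral_congr_fun measurableSet_Ioi h2, ← ofReal_integral_eq_lintegral_ofReal]
  · rw [integral_const_mul, Real.integral_rpow_mul_exp_neg_mul_Ioi hq1 hμ]
  · refine Integrable.const_mul ?_ _
    by_contra hni
    have h := Real.integral_rpow_mul_exp_neg_mul_Ioi hq1 hμ
    rw [integral_undef hni] at h
    have : 0 < (1 / μ) ^ (1 - 1 / q) * Real.Gamma (1 - 1 / q) :=
      mul_pos (by positivity) (Real.Gamma_pos_of_pos hq1)
    linarith
  · refine (ae_restrict_iff' measurableSet_Ioi).2 (Eventually.of_forall fun x hx => ?_)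
    have hx : 0 < x := hx
    have : 0 < Real.Gamma (1 / q + 1) := Real.Gamma_pos_of_pos (by positivity)
    simp only [Pi.zero_apply]
    positivity
  · fun_prop

lemma eventually_lt_integral_of_lt_piP {p μ L : ℝ} (hp : 2 ≤ p) (hμ : 0 < μ)
    (h : μ ^ (1 / p) * L < piP p) :
    ∀ᶠ Y in atTop, L < ∫ z in (0:ℝ)..Y, 2 / (μ + (p - 1) * |z| ^ (p / (p - 1))) := by
  have hκ : 0 < p - 1 := by linarith
  have hp0 : 0 < p := by linarith
  set q := p / (p - 1) with hq
  have hq1 : 1 < q := by rw [hq, one_lt_div hκ]; linarith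
  have hqi : 1 / q = 1 - 1 / p := by rw [hq]; field_simp
  have hlin := lintegral_Ioi_one_div_add_mul_rpow hμ hκ hq1
  have hval : 2 * ((p - 1) ^ (-1 / q) * Real.Gamma (1 / q + 1)
      * ((1 / μ) ^ (1 - 1 / q) * Real.Gamma (1 - 1 / q))) = piP p / μ ^ (1 / p) := by
    have hrefl := Real.Gamma_mul_Gamma_one_sub (1 / q)
    rw [Real.Gamma_add_one (by positivity)]
    have hsin : Real.sin (Real.pi * (1 / q)) = Real.sin (Real.pi / p) := by
      rw [hqi, mul_sub, mul_one, Real.sin_pi_sub, mul_one_div]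
    rw [hsin] at hrefl
    have hpow : (p - 1) ^ (-1 / q) = (p - 1) ^ (1 / p) / (p - 1) := by
      rw [← Real.rpow_sub_one hκ.ne']; congr 1
      rw [neg_div, hqi]; ring
    calc 2 * ((p - 1) ^ (-1 / q) * (1 / q * Real.Gamma (1 / q))
          * ((1 / μ) ^ (1 - 1 / q) * Real.Gamma (1 - 1 / q)))
        = 2 * (p - 1) ^ (-1 / q) * (1 / q) * (1 / μ) ^ (1 - 1 / q)
          * (Real.Gamma (1 / q) * Real.Gamma (1 - 1 / q)) := by ring
      _ = _ := by
        rw [hrefl, hpow, show 1 - 1 / q = 1 / p by rw [hqi]; ring, piP, one_div μ,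
          Real.inv_rpow hμ.le, hq]
        have : μ ^ (1 / p) ≠ 0 := by positivity
        field_simp
  have hint : IntegrableOn (fun z : ℝ => 2 / (μ + (p - 1) * |z| ^ q)) (Set.Ioi 0) := by
    have : IntegrableOn (fun z : ℝ => 1 / (μ + (p - 1) * z ^ q)) (Set.Ioi 0) := by
      refine ⟨(by fun_prop : Measurable _).aestronglyMeasurable, ?_⟩
      rw [hasFiniteIntegral_iff_ofReal, hlin]
      · exact ENNReal.ofReal_lt_top
      · refine (ae_restrict_iff' measurableSet_Ioi).2 (Eventually.of_forall fun z hz => ?_)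
        have hz : 0 < z := hz
        simp only [Pi.zero_apply]
        positivity
    refine IntegrableOn.congr_fun (this.const_mul 2) (fun z hz => ?_) measurableSet_Ioi
    rw [abs_of_pos (Set.mem_Ioi.1 hz)]
    ring
  have hI : ∫ z in Set.Ioi (0:ℝ), 2 / (μ + (p - 1) * |z| ^ q) = piP p / μ ^ (1 / p) := by
    have hnn : ∀ᵐ z ∂(volume.restrict (Set.Ioi (0:ℝ))), 0 ≤ 1 / (μ + (p - 1) * z ^ q) := by
      refine (ae_restrict_iff' measurableSet_Ioi).2 (Eventually.of_forall fun z hz => ?_)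
      have hz : 0 < z := hz
      positivity
    rw [← hval, setIntegral_congr_fun measurableSet_Ioi
      (g := fun z => 2 * (1 / (μ + (p - 1) * z ^ q))) (fun z hz => by
        simp only [abs_of_pos (Set.mem_Ioi.1 hz)]; ring), integral_const_mul,
      integral_eq_lintegral_of_nonneg_ae hnn (by fun_prop : Measurable _).aestronglyMeasurable, hlin,
      ENNReal.toReal_ofReal]
    have h1 : 0 < Real.Gamma (1 / q + 1) := Real.Gamma_pos_of_pos (by positivity)
    have h2 : 0 < Real.Gamma (1 - 1 / q) :=
      Real.Gamma_pos_of_pos (by rw [hqi]; simp only [sub_sub_cancel]; positivity)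
    positivity
  have hlim := intervalIntegral_tendsto_integral_Ioi 0 hint tendsto_id
  rw [hI] at hlim
  refine (hlim.eventually_const_lt ?_)
  rw [lt_div_iff₀ (by positivity)]
  linarith

end PiIntegral

section Riccati

open scoped Topology

/-- Integration against a nonnegative antitone weight preserves the sign of a primitive. -/
lemma setIntegral_mul_deriv_nonneg_of_antitoneOn {a b C : ℝ} {m G G' : ℝ → ℝ}
    (hmm : Measurable m) (hm0 : ∀ x, 0 ≤ m x) (hmC : ∀ x, m x ≤ C)
    (hm : AntitoneOn m (Set.Ioc a b)) (hG : ∀ x, HasDerivAt G (G' x) x) (hG' : Continuous G')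
    (hGa : G a = 0) (hG0 : ∀ x ∈ Set.Icc a b, 0 ≤ G x) :
    0 ≤ ∫ x in Set.Ioc a b, m x * G' x := by
  have hC : 0 ≤ C := (hm0 a).trans (hmC a)
  have hG'i : IntegrableOn G' (Set.Ioc a b) :=
    (hG'.integrableOn_Icc).mono_set Set.Ioc_subset_Icc_self
  have hS : MeasurableSet {z : ℝ × ℝ | z.2 < m z.1} :=
    measurableSet_lt measurable_snd (hmm.comp measurable_fst)
  have hrepr : ∀ x, m x * G' x
      = ∫ t in Set.Ioc 0 C, {z : ℝ × ℝ | z.2 < m z.1}.indicator (fun z => G' z.1) (x, t) := by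
    intro x
    have h1 : (fun t => {z : ℝ × ℝ | z.2 < m z.1}.indicator (fun z => G' z.1) (x, t))
        = (Set.Iio (m x)).indicator (fun _ => G' x) := by
      ext t; simp [Set.indicator_apply]
    have h2 : Set.Ioc 0 C ∩ Set.Iio (m x) = Set.Ioo 0 (m x) := by
      ext t
      simp only [Set.mem_inter_iff, Set.mem_Ioc, Set.mem_Iio, Set.mem_Ioo]
      exact ⟨fun h => ⟨h.1.1, h.2⟩, fun h => ⟨⟨h.1, h.2.le.trans (hmC x)⟩, h.2⟩⟩
    rw [h1, setIntegral_indicator measurableSet_Iio, h2, setIntegral_const]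
    simp [Measure.real, hm0 x]
  have hint : Integrable (fun z : ℝ × ℝ => {z : ℝ × ℝ | z.2 < m z.1}.indicator (fun z => G' z.1) z)
      ((volume.restrict (Set.Ioc a b)).prod (volume.restrict (Set.Ioc 0 C))) := by
    refine Integrable.indicator ?_ hS
    exact hG'i.comp_fst _
  simp_rw [hrepr]
  rw [integral_integral_swap (f := fun x t =>
    {z : ℝ × ℝ | z.2 < m z.1}.indicator (fun z => G' z.1) (x, t)) hint]
  refine integral_nonneg fun t => ?_
  have h1 : (fun x => {z : ℝ × ℝ | z.2 < m z.1}.indicator (fun z => G' z.1) (x, t))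
      = {x | t < m x}.indicator G' := by
    ext x; simp [Set.indicator_apply]
  simp only [Pi.zero_apply]
  rw [h1, setIntegral_indicator (measurableSet_lt measurable_const hmm)]
  rcases Set.eq_empty_or_nonempty (Set.Ioc a b ∩ {x | t < m x}) with he | hne
  · rw [he]; simp
  set S := Set.Ioc a b ∩ {x | t < m x}
  have hbdd : BddAbove S := ⟨b, fun x hx => hx.1.2⟩
  set c := sSup S with hc
  have hac : a ≤ c := by
    obtain ⟨x, hx⟩ := hne
    exact hx.1.1.le.trans (le_csSup hbdd hx)
  have hcb : c ≤ b := csSup_le hne fun x hx => hx.1.2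
  have hsub1 : Set.Ioo a c ⊆ S := by
    intro x hx
    obtain ⟨y, hy, hxy⟩ := exists_lt_of_lt_csSup hne hx.2
    have hxm : x ∈ Set.Ioc a b := ⟨hx.1, hx.2.le.trans hcb⟩
    exact ⟨hxm, lt_of_lt_of_le hy.2 (hm hxm hy.1 hxy.le)⟩
  have hsub2 : S ⊆ Set.Ioc a c := fun x hx => ⟨hx.1.1, le_csSup hbdd hx⟩
  have hae : S =ᵐ[volume] Set.Ioc a c :=
    (LE.le.eventuallyLE hsub2).antisymm
      ((Ioo_ae_eq_Ioc (μ := volume)).symm.le.trans (LE.le.eventuallyLE hsub1))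
  rw [setIntegral_congr_set hae, ← intervalIntegral.integral_of_le hac,
    intervalIntegral.integral_eq_sub_of_hasDerivAt (fun x _ => hG x) (hG'.intervalIntegrable _ _),
    hGa, sub_zero]
  exact hG0 c ⟨hac, hcb⟩

/-- A solution of the autonomous equation `y' = -D y` with `y b = 0` that stays in `[0, Y]` on
`[x₀, b]`, provided that the time needed to descend from `Y` to `0` is at least `b - x₀`. -/
lemma exists_hasDerivAt_neg_comp {D : ℝ → ℝ} (hD : Continuous D) (hD0 : ∀ z, 0 < D z)
    {x₀ b Y : ℝ} (hY : 0 ≤ Y) (hT : b - x₀ ≤ ∫ z in (0:ℝ)..Y, 1 / D z) :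
    ∃ y y' : ℝ → ℝ, (∀ x, HasDerivAt y (y' x) x) ∧ Continuous y' ∧
      ∀ x ∈ Set.Icc x₀ b, 0 ≤ y x ∧ y' x = -D (y x) := by
  let D' : ℝ → ℝ := fun z => D (Set.projIcc 0 Y hY z)
  have hD' : Continuous D' := hD.comp (continuous_subtype_val.comp continuous_projIcc)
  have hD'0 : ∀ z, 0 < D' z := fun z => hD0 _
  have hD'eq : ∀ z ∈ Set.Icc 0 Y, D' z = D z := fun z hz => by
    simp only [D', Set.projIcc_of_mem hY hz]
  obtain ⟨K, hK⟩ : ∃ K, ∀ z, D' z ≤ K := by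
    obtain ⟨K, hK⟩ := (isCompact_Icc (a := (0:ℝ)) (b := Y)).bddAbove_image hD.continuousOn
    exact ⟨K, fun z => hK ⟨_, (Set.projIcc 0 Y hY z).2, rfl⟩⟩
  have hK0 : 0 < K := (hD'0 0).trans_le (hK 0)
  have hinv : Continuous fun z => 1 / D' z := continuous_const.div hD' fun z => (hD'0 z).ne'
  let τ : ℝ → ℝ := fun z => ∫ t in (0:ℝ)..z, 1 / D' t
  have hτ : ∀ z, HasDerivAt τ (1 / D' z) z := fun z =>
    intervalIntegral.integral_hasDerivAt_right (hinv.intervalIntegrable _ _)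
      (hinv.stronglyMeasurableAtFilter _ _) hinv.continuousAt
  have hτmono : StrictMono τ := strictMono_of_hasDerivAt_pos hτ fun z => one_div_pos.2 (hD'0 z)
  have hτc : Continuous τ := continuous_iff_continuousAt.2 fun z => (hτ z).continuousAt
  have hτ0 : τ 0 = 0 := intervalIntegral.integral_same
  have hgrow : ∀ z w, z ≤ w → (w - z) / K ≤ τ w - τ z := by
    intro z w hzw
    have hmono : Monotone fun z => τ z - z / K := by
      refine monotone_of_hasDerivAt_nonneg (f' := fun z => 1 / D' z - 1 / K)
        (fun z => (hτ z).sub ((hasDerivAt_id z).div_const K)) fun z => ?_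
      exact sub_nonneg.2 (one_div_le_one_div_of_le (hD'0 z) (hK z))
    have := hmono hzw
    simp only at this
    rw [sub_div]; linarith
  have hτtop : Tendsto τ atTop atTop := by
    refine tendsto_atTop_mono' _ ?_ (tendsto_id.atTop_div_const hK0)
    filter_upwards [eventually_ge_atTop 0] with z hz
    have := hgrow 0 z hz
    simpa [hτ0] using this
  have hτbot : Tendsto τ atBot atBot := by
    refine tendsto_atBot_mono' _ ?_ (tendsto_id.atBot_div_const hK0)
    filter_upwards [eventually_le_atBot 0] with z hz
    have := hgrow z 0 hz
    simp only [hτ0, zero_sub, neg_div, id] at this ⊢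
    linarith
  let e : ℝ ≃o ℝ := hτmono.orderIsoOfSurjective τ (hτc.surjective hτtop hτbot)
  have he : ∀ z, e z = τ z := fun z => rfl
  have hσ : ∀ x, HasDerivAt e.symm (D' (e.symm x)) x := by
    intro x
    have := HasDerivAt.of_local_left_inverse (f := τ) (g := e.symm) (a := x)
      e.symm.continuous.continuousAt (hτ (e.symm x)) (one_div_pos.2 (hD'0 _)).ne'
      (Eventually.of_forall fun z => e.apply_symm_apply z)
    simpa using this
  refine ⟨fun x => e.symm (b - x), fun x => -D' (e.symm (b - x)), fun x => ?_, ?_, ?_⟩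
  · have := (hσ (b - x)).comp x ((hasDerivAt_id x).const_sub b)
    exact this.congr_deriv (by simp)
  · exact (hD'.comp (e.symm.continuous.comp (continuous_const.sub continuous_id))).neg
  · intro x hx
    have h1 : 0 ≤ e.symm (b - x) := by
      rw [e.le_symm_apply, he, hτ0]; linarith [hx.2]
    have h2 : e.symm (b - x) ≤ Y := by
      rw [e.symm_apply_le, he]
      have : τ Y = ∫ z in (0:ℝ)..Y, 1 / D z := by
        refine intervalIntegral.integral_congr fun z hz => ?_
        rw [Set.uIcc_of_le hY] at hz
        simp only [hD'eq z hz]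
      rw [this]; linarith [hx.1]
    exact ⟨h1, congrArg Neg.neg (hD'eq _ ⟨h1, h2⟩)⟩

end Riccati

section OneDimensional

open scoped Topology

lemma young_rpow {p a y v : ℝ} (hp : 1 < p) (ha : 0 ≤ a) (hy : 0 ≤ y) (hv : 0 ≤ v) :
    p * (y * v ^ (p - 1) * a) ≤ a ^ p + (p - 1) * y ^ (p / (p - 1)) * v ^ p := by
  have hp0 : 0 < p := by linarith
  have hp1 : 0 < p - 1 := by linarith
  have hc : p.HolderConjugate (p / (p - 1)) := Real.HolderConjugate.conjExponent hp
  have h := Real.young_inequality_of_nonneg ha (mul_nonneg hy (Real.rpow_nonneg hv (p - 1))) hc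
  rw [Real.mul_rpow hy (Real.rpow_nonneg hv _), ← Real.rpow_mul hv, mul_div_cancel₀ _ hp1.ne'] at h
  have h2 := mul_le_mul_of_nonneg_left h hp0.le
  have h3 : p * (a ^ p / p + y ^ (p / (p - 1)) * v ^ p / (p / (p - 1)))
      = a ^ p + (p - 1) * y ^ (p / (p - 1)) * v ^ p := by field_simp
  linarith

/-- The speed at which the Riccati variable descends under constant logarithmic slope `s`,
bounded away from zero. -/
noncomputable def riccatiSpeed (p μ s z : ℝ) : ℝ :=
  max (μ + (p - 1) * |z| ^ (p / (p - 1)) + s * z) (μ / 2)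

lemma continuous_riccatiSpeed {p : ℝ} (hp : 1 < p) (μ : ℝ) :
    Continuous fun x : ℝ × ℝ => riccatiSpeed p μ x.1 x.2 := by
  have h0 : 0 ≤ p / (p - 1) := div_nonneg (by linarith) (by linarith)
  have h1 : Continuous fun x : ℝ × ℝ => |x.2| ^ (p / (p - 1)) :=
    continuous_snd.abs.rpow_const fun _ => Or.inr h0
  unfold riccatiSpeed
  fun_prop

lemma riccatiSpeed_pos {p μ : ℝ} (hμ : 0 < μ) (s z : ℝ) : 0 < riccatiSpeed p μ s z :=
  lt_max_of_lt_right (by positivity)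

/-- Poincaré inequality on an interval for functions vanishing at the left endpoint and weights
whose logarithmic slope is at most `s`. -/
lemma setIntegral_abs_rpow_le_of_antitoneOn {p μ s x₀ b Y C : ℝ} (hp : 2 ≤ p) (hμ : 0 < μ)
    (hY : 0 ≤ Y)
    (hT : b - x₀ ≤ ∫ z in (0:ℝ)..Y, 1 / riccatiSpeed p μ s z)
    {W V V' : ℝ → ℝ} (hWm : Measurable W) (hW0 : ∀ x, 0 ≤ W x) (hWC : ∀ x, W x ≤ C)
    (hW : AntitoneOn (fun x => W x * Real.exp (-(s * x))) (Set.Ioc x₀ b))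
    (hV : ∀ x, HasDerivAt V (V' x) x) (hV' : Continuous V') (hV0 : V x₀ = 0) :
    μ * ∫ x in Set.Ioc x₀ b, |V x| ^ p * W x ≤ ∫ x in Set.Ioc x₀ b, |V' x| ^ p * W x := by
  have hp1 : 1 < p := by linarith
  have hp1' : 0 < p - 1 := by linarith
  have hp0 : 0 < p := by linarith
  have hC : 0 ≤ C := (hW0 0).trans (hWC 0)
  obtain ⟨y, y', hy, hy'c, hyD⟩ := exists_hasDerivAt_neg_comp
    (D := riccatiSpeed p μ s) ((continuous_riccatiSpeed hp1 μ).comp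
      (by fun_prop : Continuous fun z => (s, z)))
    (riccatiSpeed_pos hμ s) hY hT
  have hyc : Continuous y := continuous_iff_continuousAt.2 fun x => (hy x).continuousAt
  have hVc : Continuous V := continuous_iff_continuousAt.2 fun x => (hV x).continuousAt
  have hVp : Continuous fun x => |V x| ^ p := hVc.abs.rpow_const fun _ => Or.inr hp0.le
  have hVp2 : Continuous fun x => |V x| ^ (p - 2) :=
    hVc.abs.rpow_const fun _ => Or.inr (by linarith)
  have hV'p : Continuous fun x => |V' x| ^ p := hV'.abs.rpow_const fun _ => Or.inr hp0.le
  let G : ℝ → ℝ := fun x => Real.exp (s * x) * (y x * |V x| ^ p)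
  let G' : ℝ → ℝ := fun x => Real.exp (s * x) * s * (y x * |V x| ^ p)
    + Real.exp (s * x) * (y' x * |V x| ^ p + y x * (p * |V x| ^ (p - 2) * V x * V' x))
  have hG : ∀ x, HasDerivAt G (G' x) x := fun x => by
    have h1 : HasDerivAt (fun x => Real.exp (s * x)) (Real.exp (s * x) * s) x := by
      have := ((hasDerivAt_id x).const_mul s).exp
      simpa using this
    exact h1.mul ((hy x).mul ((hasDerivAt_abs_rpow (V x) hp1).comp x (hV x)))
  have hG'c : Continuous G' := by simp only [G']; fun_prop
  have hle : ∀ x ∈ Set.Ioc x₀ b, G' x ≤ Real.exp (s * x) * (|V' x| ^ p - μ * |V x| ^ p) := by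
    intro x hx
    obtain ⟨hy0, hyx⟩ := hyD x ⟨hx.1.le, hx.2⟩
    have h1 : y' x ≤ -(μ + (p - 1) * y x ^ (p / (p - 1)) + s * y x) := by
      rw [hyx, riccatiSpeed, abs_of_nonneg hy0]
      exact neg_le_neg (le_max_left _ _)
    have h2 := young_rpow hp1 (abs_nonneg (V' x)) hy0 (abs_nonneg (V x))
    have h3 : y x * (p * |V x| ^ (p - 2) * V x * V' x) ≤ p * (y x * |V x| ^ (p - 1) * |V' x|) := by
      rw [← rpow_sub_two_mul_self (abs_nonneg (V x)) (by linarith : p ≠ 1)]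
      have h4 : V x * V' x ≤ |V x| * |V' x| := by rw [← abs_mul]; exact le_abs_self _
      have h5 : 0 ≤ p * y x * |V x| ^ (p - 2) := by positivity
      nlinarith [mul_le_mul_of_nonneg_left h4 h5]
    have h6 : 0 ≤ |V x| ^ p := by positivity
    have h7 := mul_le_mul_of_nonneg_right h1 h6
    have : G' x = Real.exp (s * x) * (s * y x * |V x| ^ p + y' x * |V x| ^ p
      + y x * (p * |V x| ^ (p - 2) * V x * V' x)) := by simp only [G']; ring
    rw [this]
    refine mul_le_mul_of_nonneg_left ?_ (Real.exp_pos _).le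
    linarith
  let m : ℝ → ℝ := (Set.Ioc x₀ b).indicator fun x => W x * Real.exp (-(s * x))
  have hm_eq : ∀ x ∈ Set.Ioc x₀ b, m x = W x * Real.exp (-(s * x)) := fun x hx =>
    Set.indicator_of_mem hx _
  obtain ⟨K, hK⟩ : ∃ K, ∀ x ∈ Set.Icc x₀ b, Real.exp (-(s * x)) ≤ K := by
    obtain ⟨K, hK⟩ := (isCompact_Icc (a := x₀) (b := b)).bddAbove_image
      (f := fun x => Real.exp (-(s * x))) (by fun_prop)
    exact ⟨K, fun x hx => hK ⟨x, hx, rfl⟩⟩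
  have hkey := setIntegral_mul_deriv_nonneg_of_antitoneOn (a := x₀) (b := b) (C := C * |K|) (m := m)
    ((hWm.mul (by fun_prop)).indicator measurableSet_Ioc)
    (fun x => Set.indicator_nonneg (fun x _ => mul_nonneg (hW0 x) (Real.exp_pos _).le) x)
    (fun x => by
      by_cases hx : x ∈ Set.Ioc x₀ b
      · rw [hm_eq x hx]
        exact mul_le_mul (hWC x) ((hK x ⟨hx.1.le, hx.2⟩).trans (le_abs_self K))
          (Real.exp_pos _).le hC
      · rw [show m x = 0 from Set.indicator_of_notMem hx _]
        positivity)
    (fun x hx z hz hxz => by rw [hm_eq x hx, hm_eq z hz]; exact hW hx hz hxz)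
    hG hG'c (by simp [G, hV0, hp0.ne'])
    (fun x hx => mul_nonneg (Real.exp_pos _).le
      (mul_nonneg (hyD x hx).1 (Real.rpow_nonneg (abs_nonneg _) _)))
  have hWi : ∀ f : ℝ → ℝ, Continuous f → IntegrableOn (fun x => f x * W x) (Set.Ioc x₀ b) := by
    intro f hf
    have hfi : IntegrableOn f (Set.Ioc x₀ b) :=
      (hf.integrableOn_Icc).mono_set Set.Ioc_subset_Icc_self
    refine Integrable.mul_bdd hfi hWm.aestronglyMeasurable (c := C)
      (Eventually.of_forall fun x => ?_)
    rw [Real.norm_of_nonneg (hW0 x)]; exact hWC x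
  have hmono : ∫ x in Set.Ioc x₀ b, m x * G' x
      ≤ ∫ x in Set.Ioc x₀ b, (|V' x| ^ p * W x - μ * (|V x| ^ p * W x)) := by
    refine setIntegral_mono_on ?_ ?_ measurableSet_Ioc fun x hx => ?_
    · refine IntegrableOn.congr_fun
        (hWi (fun x => G' x * Real.exp (-(s * x))) (by fun_prop)) (fun x hx => ?_)
        measurableSet_Ioc
      rw [hm_eq x hx]; ring
    · exact (hWi _ hV'p).sub ((hWi _ hVp).const_mul μ)
    · rw [hm_eq x hx]
      have h1 := mul_le_mul_of_nonneg_left (hle x hx)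
        (mul_nonneg (hW0 x) (Real.exp_pos (-(s * x))).le)
      refine h1.trans (le_of_eq ?_)
      have : Real.exp (-(s * x)) * Real.exp (s * x) = 1 := by rw [← Real.exp_add]; simp
      linear_combination W x * (|V' x| ^ p - μ * |V x| ^ p) * this
  rw [integral_sub (hWi _ hV'p) ((hWi _ hVp).const_mul μ), integral_const_mul] at hmono
  linarith

end OneDimensional

section PayneWeinberger

open scoped Topology

lemma exists_monotoneOn_antitoneOn {a b : ℝ} (hab : a ≤ b) {f : ℝ → ℝ}
    (hf : ∀ x y z, x ≤ y → y ≤ z → min (f x) (f z) ≤ f y) :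
    ∃ x ∈ Set.Icc a b, MonotoneOn f (Set.Ico a x) ∧ AntitoneOn f (Set.Ioc x b) := by
  set S := {x | x ∈ Set.Icc a b ∧ MonotoneOn f (Set.Ico a x)} with hS
  have haS : a ∈ S := ⟨⟨le_rfl, hab⟩, by simp [MonotoneOn]⟩
  have hbdd : BddAbove S := ⟨b, fun x hx => hx.1.2⟩
  refine ⟨sSup S, ⟨le_csSup hbdd haS, csSup_le ⟨a, haS⟩ fun x hx => hx.1.2⟩, ?_, ?_⟩
  · intro u hu v hv huv
    obtain ⟨x, hx, hvx⟩ := exists_lt_of_lt_csSup ⟨a, haS⟩ hv.2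
    exact hx.2 ⟨hu.1, huv.trans_lt hvx⟩ ⟨hv.1, hvx⟩ huv
  · intro u hu v hv huv
    by_contra! hlt
    refine hu.1.not_ge (le_csSup hbdd ⟨⟨(le_csSup hbdd haS).trans hu.1.le, hu.2⟩, ?_⟩)
    intro r hr t ht hrt
    by_contra! hlt2
    have h1 := hf r t u hrt ht.2.le
    have h2 := hf t u v ht.2.le huv
    have h3 := hf r u v hr.2.le huv
    rw [min_le_iff] at h1 h2 h3
    rcases h1 with h1 | h1 <;> rcases h2 with h2 | h2 <;> rcases h3 with h3 | h3 <;> linarith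

/-- The time needed by the Riccati variable to descend from `Y` to `0`. -/
noncomputable def riccatiTime (p μ Y s : ℝ) : ℝ :=
  ∫ z in (0:ℝ)..Y, 1 / riccatiSpeed p μ s z

lemma continuous_one_div_riccatiSpeed {p μ : ℝ} (hp : 1 < p) (hμ : 0 < μ) :
    Continuous fun x : ℝ × ℝ => 1 / riccatiSpeed p μ x.1 x.2 :=
  continuous_const.div (continuous_riccatiSpeed hp μ) fun _ => (riccatiSpeed_pos hμ _ _).ne'

lemma intervalIntegrable_one_div_riccatiSpeed {p μ : ℝ} (hp : 1 < p) (hμ : 0 < μ) (s y z : ℝ) :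
    IntervalIntegrable (fun z => 1 / riccatiSpeed p μ s z) volume y z :=
  ((continuous_one_div_riccatiSpeed hp hμ).comp
    (by fun_prop : Continuous fun z : ℝ => (s, z))).intervalIntegrable _ _

lemma continuous_riccatiTime {p μ : ℝ} (hp : 1 < p) (hμ : 0 < μ) (Y : ℝ) :
    Continuous (riccatiTime p μ Y) :=
  intervalIntegral.continuous_parametric_intervalIntegral_of_continuous'
    (f := fun s z => 1 / riccatiSpeed p μ s z) (continuous_one_div_riccatiSpeed hp hμ) 0 Y

lemma two_div_le_one_div_riccatiSpeed_add {p μ : ℝ} (hp : 1 < p) (hμ : 0 < μ) (s z : ℝ) :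
    2 / (μ + (p - 1) * |z| ^ (p / (p - 1)))
      ≤ 1 / riccatiSpeed p μ s z + 1 / riccatiSpeed p μ (-s) z := by
  have h0 : 0 ≤ (p - 1) * |z| ^ (p / (p - 1)) := by
    have : 0 ≤ p - 1 := by linarith
    positivity
  set A := μ + (p - 1) * |z| ^ (p / (p - 1)) with hA
  have hAμ : μ ≤ A := by linarith
  have hA0 : 0 < A := by linarith
  have hlow : 2 / A ≤ 1 / (μ / 2) := by
    rw [div_le_div_iff₀ hA0 (by positivity)]; linarith
  have h1 := one_div_pos.2 (riccatiSpeed_pos (p := p) hμ s z)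
  have h2 := one_div_pos.2 (riccatiSpeed_pos (p := p) hμ (-s) z)
  unfold riccatiSpeed at *
  rw [← hA] at *
  rcases le_total (A + s * z) (μ / 2) with h | h
  · rw [max_eq_right h] at *; linarith
  rcases le_total (A + -s * z) (μ / 2) with h' | h'
  · rw [max_eq_right h'] at *; linarith
  have hμ2 : 0 < μ / 2 := by positivity
  have h3 : 0 < A + s * z := by linarith
  have h4 : 0 < A + -s * z := by linarith
  rw [max_eq_left h, max_eq_left h', div_add_div _ _ h3.ne' h4.ne',
    div_le_div_iff₀ hA0 (by positivity)]
  nlinarith [sq_nonneg (s * z)]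

lemma le_riccatiTime_add {p μ Y : ℝ} (hp : 1 < p) (hμ : 0 < μ) (hY : 0 ≤ Y) (s : ℝ) :
    ∫ z in (0:ℝ)..Y, 2 / (μ + (p - 1) * |z| ^ (p / (p - 1)))
      ≤ riccatiTime p μ Y s + riccatiTime p μ Y (-s) := by
  unfold riccatiTime
  rw [← intervalIntegral.integral_add (intervalIntegrable_one_div_riccatiSpeed hp hμ _ _ _)
    (intervalIntegrable_one_div_riccatiSpeed hp hμ _ _ _)]
  have h1 : Continuous fun z : ℝ => |z| ^ (p / (p - 1)) :=
    continuous_abs.rpow_const fun _ => Or.inr (div_nonneg (by linarith) (by linarith))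
  refine intervalIntegral.integral_mono_on hY ?_
    ((intervalIntegrable_one_div_riccatiSpeed hp hμ _ _ _).add
      (intervalIntegrable_one_div_riccatiSpeed hp hμ _ _ _))
    fun z _ => two_div_le_one_div_riccatiSpeed_add hp hμ s z
  refine (Continuous.div continuous_const (by fun_prop) fun z => ?_).intervalIntegrable _ _
  have : 0 < p - 1 := by linarith
  positivity

lemma exists_le_riccatiTime {p μ Y : ℝ} (hp : 1 < p) (hμ : 0 < μ) (hY : 0 < Y) :
    ∃ s, Y / μ ≤ riccatiTime p μ Y s := by
  have hp1 : 0 < p - 1 := by linarith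
  set K := μ + (p - 1) * Y ^ (p / (p - 1)) with hK
  have hK0 : 0 < K := by positivity
  refine ⟨-(2 * K / Y), ?_⟩
  have hspeed : ∀ z ∈ Set.Icc (Y / 2) Y, 1 / riccatiSpeed p μ (-(2 * K / Y)) z = 2 / μ := by
    intro z hz
    have hz0 : 0 ≤ z := by linarith [hz.1]
    have h1 : z ^ (p / (p - 1)) ≤ Y ^ (p / (p - 1)) :=
      Real.rpow_le_rpow hz0 hz.2 (by positivity)
    have h2 : K ≤ 2 * K / Y * z := by
      rw [div_mul_eq_mul_div, le_div_iff₀ hY]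
      nlinarith [hz.1]
    have h3 := mul_le_mul_of_nonneg_left h1 hp1.le
    rw [riccatiSpeed, abs_of_nonneg hz0, max_eq_right (by linarith), one_div_div]
  have hsplit := intervalIntegral.integral_add_adjacent_intervals
    (intervalIntegrable_one_div_riccatiSpeed hp hμ (-(2 * K / Y)) 0 (Y / 2))
    (intervalIntegrable_one_div_riccatiSpeed hp hμ (-(2 * K / Y)) (Y / 2) Y)
  have hfst : 0 ≤ ∫ z in (0:ℝ)..(Y / 2), 1 / riccatiSpeed p μ (-(2 * K / Y)) z :=
    intervalIntegral.integral_nonneg (by positivity) fun z _ =>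
      (one_div_pos.2 (riccatiSpeed_pos hμ _ _)).le
  have hsnd : ∫ z in (Y / 2)..Y, 1 / riccatiSpeed p μ (-(2 * K / Y)) z = Y / μ := by
    rw [intervalIntegral.integral_congr (g := fun _ => 2 / μ) fun z hz => hspeed z (by
      rwa [Set.uIcc_of_le (by linarith)] at hz), intervalIntegral.integral_const, smul_eq_mul]
    field_simp
    ring
  rw [riccatiTime, ← hsplit, hsnd]
  linarith

lemma exists_balanced_slope {a b : ℝ} (hab : a ≤ b) {W T : ℝ → ℝ} (hT : Continuous T)
    (hTT : ∀ s, b - a ≤ T s + T (-s)) (hTs : ∃ s, b - a ≤ T s)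
    (hW : ∀ s x y z, x ≤ y → y ≤ z →
      min (W x * Real.exp (-(s * x))) (W z * Real.exp (-(s * z))) ≤ W y * Real.exp (-(s * y))) :
    ∃ s, ∃ x ∈ Set.Icc a b, x - a ≤ T (-s) ∧ b - x ≤ T s ∧
      MonotoneOn (fun x => W x * Real.exp (-(s * x))) (Set.Ico a x) ∧
      AntitoneOn (fun x => W x * Real.exp (-(s * x))) (Set.Ioc x b) := by
  let m : ℝ → ℝ → ℝ := fun s x => W x * Real.exp (-(s * x))
  let D : Set (ℝ × Set.Icc a b) :=
    {z | MonotoneOn (m z.1) (Set.Ico a z.2) ∧ AntitoneOn (m z.1) (Set.Ioc (z.2 : ℝ) b)}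
  have hmc : ∀ x, Continuous fun z : ℝ × Set.Icc a b => m z.1 x := fun x => by
    simp only [m]; fun_prop
  have hval : Continuous fun z : ℝ × Set.Icc a b => (z.2 : ℝ) :=
    continuous_subtype_val.comp continuous_snd
  have hD : IsClosed D := by
    have h1 : D = (⋂ u ∈ Set.Ici a, ⋂ v ∈ Set.Ici u,
          ({z | (z.2 : ℝ) ≤ v} ∪ {z | m z.1 u ≤ m z.1 v}))
        ∩ (⋂ v ∈ Set.Iic b, ⋂ u ∈ Set.Iic v,
          ({z | u ≤ (z.2 : ℝ)} ∪ {z | m z.1 v ≤ m z.1 u})) := by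
      ext z
      simp only [D, Set.mem_inter_iff, Set.mem_iInter, Set.mem_union, Set.mem_ofPred_eq,
        Set.mem_Ici, Set.mem_Iic]
      constructor
      · rintro ⟨h1, h2⟩
        refine ⟨fun u hu v hv => ?_, fun v hv u hu => ?_⟩
        · rcases le_or_gt (z.2 : ℝ) v with h | h
          · exact Or.inl h
          · exact Or.inr (h1 ⟨hu, hv.trans_lt h⟩ ⟨hu.trans hv, h⟩ hv)
        · rcases le_or_gt u (z.2 : ℝ) with h | h
          · exact Or.inl h
          · exact Or.inr (h2 ⟨h, hu.trans hv⟩ ⟨h.trans_le hu, hv⟩ hu)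
      · rintro ⟨h1, h2⟩
        refine ⟨fun u hu v hv huv => ?_, fun u hu v hv huv => ?_⟩
        · exact (h1 u hu.1 v huv).resolve_left (not_le.2 hv.2)
        · exact (h2 v hv.2 u huv).resolve_left (not_le.2 hu.1)
    rw [h1]
    refine IsClosed.inter ?_ ?_
    · exact isClosed_biInter fun u _ => isClosed_biInter fun v _ =>
        (isClosed_le hval continuous_const).union (isClosed_le (hmc u) (hmc v))
    · exact isClosed_biInter fun v _ => isClosed_biInter fun u _ =>
        (isClosed_le continuous_const hval).union (isClosed_le (hmc v) (hmc u))
  let S₁ : Set ℝ := Prod.fst '' (D ∩ {z | (z.2 : ℝ) - a ≤ T (-z.1)})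
  let S₂ : Set ℝ := Prod.fst '' (D ∩ {z | b - (z.2 : ℝ) ≤ T z.1})
  have hS₁ : IsClosed S₁ := isClosedMap_fst_of_compactSpace _
    (hD.inter (isClosed_le (hval.sub continuous_const) (hT.comp continuous_fst.neg)))
  have hS₂ : IsClosed S₂ := isClosedMap_fst_of_compactSpace _
    (hD.inter (isClosed_le (continuous_const.sub hval) (hT.comp continuous_fst)))
  have hex : ∀ s, ∃ x : Set.Icc a b, (s, x) ∈ D := fun s => by
    obtain ⟨x, hx, h1, h2⟩ := exists_monotoneOn_antitoneOn hab (hW s)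
    exact ⟨⟨x, hx⟩, h1, h2⟩
  have hcover : (Set.univ : Set ℝ) ⊆ S₁ ∪ S₂ := fun s _ => by
    obtain ⟨x, hx⟩ := hex s
    rcases le_total ((x : ℝ) - a) (T (-s)) with h | h
    · exact Or.inl ⟨(s, x), ⟨hx, h⟩, rfl⟩
    · refine Or.inr ⟨(s, x), ⟨hx, ?_⟩, rfl⟩
      have := hTT s
      simp only [Set.mem_ofPred_eq]
      linarith
  obtain ⟨s₀, hs₀⟩ := hTs
  obtain ⟨s, -, ⟨⟨s', x₁⟩, hx₁, rfl⟩, ⟨⟨s'', x₂⟩, hx₂, heq⟩⟩ :=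
    isPreconnected_closed_iff.1 isPreconnected_univ S₁ S₂ hS₁ hS₂ hcover
      (by
        obtain ⟨x, hx⟩ := hex (-s₀)
        refine ⟨-s₀, trivial, (-s₀, x), ⟨hx, ?_⟩, rfl⟩
        simp only [Set.mem_ofPred_eq, neg_neg]
        linarith [x.2.2])
      (by
        obtain ⟨x, hx⟩ := hex s₀
        refine ⟨s₀, trivial, (s₀, x), ⟨hx, ?_⟩, rfl⟩
        simp only [Set.mem_ofPred_eq]
        linarith [x.2.1])
  simp only at heq
  subst heq
  obtain ⟨⟨hm₁, ha₁⟩, h₁⟩ := hx₁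
  obtain ⟨⟨hm₂, ha₂⟩, h₂⟩ := hx₂
  simp only [Set.mem_ofPred_eq] at *
  rcases le_or_gt (b - (x₁ : ℝ)) (T s'') with h | h
  · exact ⟨s'', x₁, x₁.2, h₁, h, hm₁, ha₁⟩
  rcases le_or_gt ((x₂ : ℝ) - a) (T (-s'')) with h' | h'
  · exact ⟨s'', x₂, x₂.2, h', h₂, hm₂, ha₂⟩
  have h3 := hTT s''
  refine ⟨s'', b - T s'', ⟨by linarith [x₁.2.1], by linarith [x₂.2.2]⟩, by linarith, by linarith,
    hm₂.mono (Set.Ico_subset_Ico_right (by linarith)),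
    ha₁.mono (Set.Ioc_subset_Ioc_left (by linarith))⟩

/-- Weighted `L^p` Poincaré inequality on an interval for weights that are log-concave, in the
form of quasi-concavity after every exponential tilt. -/
lemma exists_setIntegral_abs_sub_rpow_le {a b p μ C : ℝ} (hab : a ≤ b) (hp : 2 ≤ p) (hμ : 0 < μ)
    (hL : μ ^ (1 / p) * (b - a) < piP p) {W : ℝ → ℝ}
    (hWm : Measurable W) (hW0 : ∀ x, 0 ≤ W x) (hWC : ∀ x, W x ≤ C)
    (hW : ∀ s x y z, x ≤ y → y ≤ z →
      min (W x * Real.exp (-(s * x))) (W z * Real.exp (-(s * z))) ≤ W y * Real.exp (-(s * y))) :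
    ∃ x₀ ∈ Set.Icc a b, ∀ V V' : ℝ → ℝ, (∀ x, HasDerivAt V (V' x) x) → Continuous V' →
      μ * ∫ x in Set.Ioc a b, |V x - V x₀| ^ p * W x ≤ ∫ x in Set.Ioc a b, |V' x| ^ p * W x := by
  have hp1 : 1 < p := by linarith
  have hp0 : 0 < p := by linarith
  obtain ⟨Y, hY, hYμ, hY0⟩ := ((eventually_lt_integral_of_lt_piP hp hμ hL).and
    ((eventually_ge_atTop ((b - a) * μ)).and (eventually_gt_atTop 0))).exists
  obtain ⟨s, x₀, hx₀, hx₀a, hx₀b, hmono, hanti⟩ := exists_balanced_slope hab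
    (continuous_riccatiTime hp1 hμ Y)
    (fun s => hY.le.trans (le_riccatiTime_add hp1 hμ hY0.le s))
    (by
      obtain ⟨s, hs⟩ := exists_le_riccatiTime hp1 hμ hY0
      exact ⟨s, ((le_div_iff₀ hμ).2 hYμ).trans hs⟩) hW
  refine ⟨x₀, hx₀, fun V V' hV hV' => ?_⟩
  have hVc : Continuous V := continuous_iff_continuousAt.2 fun x => (hV x).continuousAt
  have hright := setIntegral_abs_rpow_le_of_antitoneOn (V := fun x => V x - V x₀) (V' := V')
    hp hμ hY0.le hx₀b hWm hW0 hWC hanti (fun x => (hV x).sub_const _) hV' (sub_self _)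
  have hleft := setIntegral_abs_rpow_le_of_antitoneOn (x₀ := -x₀) (b := -a) (s := -s)
    (W := fun x => W (-x)) (V := fun x => V (-x) - V x₀) (V' := fun x => -V' (-x))
    hp hμ hY0.le (by rw [riccatiTime] at hx₀a; linarith) (hWm.comp measurable_neg)
    (fun x => hW0 _) (fun x => hWC _)
    (fun u hu v hv huv => by
      have := hmono (a := -v) ⟨by linarith [hv.2], by linarith [hv.1]⟩ (b := -u)
        ⟨by linarith [hu.2], by linarith [hu.1]⟩ (by linarith)
      simpa using this)
    (fun x => by
      have := ((hV (-x)).comp x (hasDerivAt_neg x)).sub_const (V x₀)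
      exact this.congr_deriv (by simp))
    (hV'.comp continuous_neg).neg (by simp)
  have hrefl : ∀ f : ℝ → ℝ, ∫ x in Set.Ioc (-x₀) (-a), f (-x) = ∫ x in Set.Ioc a x₀, f x :=
    fun f => by
      rw [← intervalIntegral.integral_of_le (by linarith [hx₀.1]),
        ← intervalIntegral.integral_of_le hx₀.1, intervalIntegral.integral_comp_neg,
        neg_neg, neg_neg]
  rw [hrefl fun x => |V x - V x₀| ^ p * W x] at hleft
  simp only [abs_neg] at hleft
  rw [hrefl fun x => |V' x| ^ p * W x] at hleft
  have hint : ∀ f : ℝ → ℝ, Continuous f → ∀ c d,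
      IntegrableOn (fun x => f x * W x) (Set.Ioc c d) := by
    intro f hf c d
    refine Integrable.mul_bdd ((hf.integrableOn_Icc).mono_set Set.Ioc_subset_Icc_self)
      hWm.aestronglyMeasurable (c := C) (Eventually.of_forall fun x => ?_)
    rw [Real.norm_of_nonneg (hW0 x)]; exact hWC x
  have hsplit : ∀ f : ℝ → ℝ, Continuous f → ∫ x in Set.Ioc a b, f x * W x
      = (∫ x in Set.Ioc a x₀, f x * W x) + ∫ x in Set.Ioc x₀ b, f x * W x := by
    intro f hf
    rw [← Set.Ioc_union_Ioc_eq_Ioc hx₀.1 hx₀.2, setIntegral_union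
      (Set.Ioc_disjoint_Ioc_of_le le_rfl) measurableSet_Ioc (hint f hf _ _) (hint f hf _ _)]
  have hVp : Continuous fun x => |V x - V x₀| ^ p :=
    (hVc.sub continuous_const).abs.rpow_const fun _ => Or.inr hp0.le
  rw [hsplit _ hVp,
    hsplit _ (hV'.abs.rpow_const fun _ => Or.inr hp0.le), mul_add]
  exact add_le_add hleft hright

end PayneWeinberger

section PrekopaLine

open scoped Pointwise

lemma volume_le_of_bounds {A : Set ℝ} (hb : BddBelow A) (hb' : BddAbove A) :
    volume A ≤ ENNReal.ofReal (sSup A - sInf A) := by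
  refine (measure_mono fun x hx => ?_ : volume A ≤ volume (Set.Icc (sInf A) (sSup A))).trans ?_
  · exact ⟨csInf_le hb hx, le_csSup hb' hx⟩
  · rw [Real.volume_Icc]

/-- The one-dimensional Brunn-Minkowski inequality for intervals. -/
lemma ofReal_mul_volume_add_le {A B H : Set ℝ} {t R : ℝ} (ht0 : 0 < t) (ht1 : t < 1)
    (hA : Convex ℝ A) (hB : Convex ℝ B) (hAne : A.Nonempty) (hBne : B.Nonempty)
    (hAR : ∀ x ∈ A, |x| ≤ R) (hBR : ∀ x ∈ B, |x| ≤ R)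
    (hH : ∀ x ∈ A, ∀ y ∈ B, t * x + (1 - t) * y ∈ H) :
    ENNReal.ofReal t * volume A + ENNReal.ofReal (1 - t) * volume B ≤ volume H := by
  have hbA : BddBelow A := ⟨-R, fun x hx => (abs_le.1 (hAR x hx)).1⟩
  have hbA' : BddAbove A := ⟨R, fun x hx => (abs_le.1 (hAR x hx)).2⟩
  have hbB : BddBelow B := ⟨-R, fun x hx => (abs_le.1 (hBR x hx)).1⟩
  have hbB' : BddAbove B := ⟨R, fun x hx => (abs_le.1 (hBR x hx)).2⟩
  have hs : 0 < 1 - t := by linarith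
  have hdA : 0 ≤ sSup A - sInf A := sub_nonneg.2 (Real.sInf_le_sSup A hbA hbA')
  have hdB : 0 ≤ sSup B - sInf B := sub_nonneg.2 (Real.sInf_le_sSup B hbB hbB')
  calc ENNReal.ofReal t * volume A + ENNReal.ofReal (1 - t) * volume B
      ≤ ENNReal.ofReal t * ENNReal.ofReal (sSup A - sInf A)
        + ENNReal.ofReal (1 - t) * ENNReal.ofReal (sSup B - sInf B) := by
        gcongr
        · exact volume_le_of_bounds hbA hbA'
        · exact volume_le_of_bounds hbB hbB'
    _ = volume (Set.Ioo (t * sInf A + (1 - t) * sInf B) (t * sSup A + (1 - t) * sSup B)) := by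
        rw [← ENNReal.ofReal_mul ht0.le, ← ENNReal.ofReal_mul hs.le,
          ← ENNReal.ofReal_add (by positivity) (by positivity), Real.volume_Ioo]
        congr 1; ring
    _ ≤ volume H := by
        refine measure_mono fun z hz => ?_
        have hconv : Convex ℝ (t • A + (1 - t) • B) := (hA.smul t).add (hB.smul (1 - t))
        have hmem : ∀ x ∈ A, ∀ y ∈ B, t * x + (1 - t) * y ∈ t • A + (1 - t) • B :=
          fun x hx y hy => Set.add_mem_add (Set.smul_mem_smul_set hx) (Set.smul_mem_smul_set hy)
        set ε := min (z - (t * sInf A + (1 - t) * sInf B))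
          (t * sSup A + (1 - t) * sSup B - z) with hε
        have hε0 : 0 < ε := lt_min (sub_pos.2 hz.1) (sub_pos.2 hz.2)
        obtain ⟨a, ha, ha'⟩ := exists_lt_of_csInf_lt hAne (lt_add_of_pos_right (sInf A) hε0)
        obtain ⟨b, hb, hb'⟩ := exists_lt_of_csInf_lt hBne (lt_add_of_pos_right (sInf B) hε0)
        obtain ⟨c, hc, hc'⟩ := exists_lt_of_lt_csSup hAne (sub_lt_self (sSup A) hε0)
        obtain ⟨d, hd, hd'⟩ := exists_lt_of_lt_csSup hBne (sub_lt_self (sSup B) hε0)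
        have h1 : ε ≤ z - (t * sInf A + (1 - t) * sInf B) := min_le_left _ _
        have h2 : ε ≤ t * sSup A + (1 - t) * sSup B - z := min_le_right _ _
        have hzm : z ∈ t • A + (1 - t) • B :=
          hconv.ordConnected.out (hmem a ha b hb) (hmem c hc d hd)
            ⟨by nlinarith, by nlinarith⟩
        obtain ⟨x, ⟨x', hx', rfl⟩, y, ⟨y', hy', rfl⟩, rfl⟩ := hzm
        exact hH x' hx' y' hy'

lemma integrable_of_bounded_support {f : ℝ → ℝ} {C R : ℝ} (hf : Measurable f)
    (hf0 : ∀ x, 0 ≤ f x) (hfC : ∀ x, f x ≤ C) (hfR : ∀ x, R < |x| → f x = 0) : Integrable f := by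
  have h1 : f = (Set.Icc (-R) R).indicator f := by
    ext x
    by_cases hx : x ∈ Set.Icc (-R) R
    · rw [Set.indicator_of_mem hx]
    · rw [Set.indicator_of_notMem hx, hfR x]
      by_contra! h
      exact hx (abs_le.1 h)
  rw [h1, integrable_indicator_iff measurableSet_Icc]
  refine Measure.integrableOn_of_bounded (M := C) (by simp) hf.aestronglyMeasurable
    (Eventually.of_forall fun x => ?_)
  rw [Real.norm_of_nonneg (hf0 x)]
  exact hfC x

lemma mul_integral_add_le_of_normalized {f g h : ℝ → ℝ} {t C R : ℝ} (ht0 : 0 < t) (ht1 : t < 1)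
    (hf : Measurable f) (hg : Measurable g) (hh : Measurable h)
    (hf0 : ∀ x, 0 ≤ f x) (hg0 : ∀ x, 0 ≤ g x) (hh0 : ∀ x, 0 ≤ h x)
    (hf1 : ∀ x, f x ≤ 1) (hg1 : ∀ x, g x ≤ 1) (hhC : ∀ x, h x ≤ C)
    (hfR : ∀ x, R < |x| → f x = 0) (hgR : ∀ x, R < |x| → g x = 0) (hhR : ∀ x, R < |x| → h x = 0)
    (hfc : ∀ c, 0 < c → Convex ℝ {x | c < f x}) (hgc : ∀ c, 0 < c → Convex ℝ {x | c < g x})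
    (hfs : ∀ c < 1, ∃ x, c < f x) (hgs : ∀ c < 1, ∃ x, c < g x)
    (hfgh : ∀ x y, f x ^ t * g y ^ (1 - t) ≤ h (t * x + (1 - t) * y)) :
    t * (∫ x, f x) + (1 - t) * (∫ x, g x) ≤ ∫ x, h x := by
  have hs : 0 < 1 - t := by linarith
  have hfi := integrable_of_bounded_support hf hf0 hf1 hfR
  have hgi := integrable_of_bounded_support hg hg0 hg1 hgR
  have hhi := integrable_of_bounded_support hh hh0 hhC hhR
  have hmeas : ∀ k : ℝ → ℝ, Measurable fun c => volume {x | c < k x} := fun k =>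
    Antitone.measurable fun c d hcd => measure_mono fun x hx => lt_of_le_of_lt hcd hx
  have key : ENNReal.ofReal t * (∫⁻ x, ENNReal.ofReal (f x))
      + ENNReal.ofReal (1 - t) * (∫⁻ x, ENNReal.ofReal (g x)) ≤ ∫⁻ x, ENNReal.ofReal (h x) := by
    rw [lintegral_eq_lintegral_meas_lt _ (Eventually.of_forall hf0) hf.aemeasurable,
      lintegral_eq_lintegral_meas_lt _ (Eventually.of_forall hg0) hg.aemeasurable,
      lintegral_eq_lintegral_meas_lt _ (Eventually.of_forall hh0) hh.aemeasurable,
      ← lintegral_const_mul _ (hmeas f), ← lintegral_const_mul _ (hmeas g),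
      ← lintegral_add_left ((hmeas f).const_mul _)]
    refine setLIntegral_mono' measurableSet_Ioi fun c hc => ?_
    have hc : 0 < c := hc
    rcases lt_or_ge c 1 with hc1 | hc1
    · have hR : ∀ k : ℝ → ℝ, (∀ x, R < |x| → k x = 0) → ∀ x ∈ {x | c < k x}, |x| ≤ R := by
        intro k hk x hx
        by_contra! hlt
        have hx : c < k x := hx
        rw [hk x hlt] at hx
        linarith
      refine ofReal_mul_volume_add_le ht0 ht1 (hfc c hc) (hgc c hc) (hfs c hc1) (hgs c hc1)
        (hR f hfR) (hR g hgR) fun x hx y hy => lt_of_lt_of_le ?_ (hfgh x y)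
      have hx : c < f x := hx
      have hy : c < g y := hy
      calc c = c ^ t * c ^ (1 - t) := by rw [← Real.rpow_add hc]; simp
        _ < f x ^ t * g y ^ (1 - t) :=
          mul_lt_mul'' (Real.rpow_lt_rpow hc.le hx ht0) (Real.rpow_lt_rpow hc.le hy hs)
            (by positivity) (by positivity)
    · have hempty : ∀ k : ℝ → ℝ, (∀ x, k x ≤ 1) → {x | c < k x} = ∅ := fun k hk =>
        Set.eq_empty_of_forall_notMem fun x hx => (lt_of_le_of_lt hc1 hx).not_ge (hk x)
      rw [hempty f hf1, hempty g hg1]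
      simp
  rw [← ofReal_integral_eq_lintegral_ofReal hfi (Eventually.of_forall hf0),
    ← ofReal_integral_eq_lintegral_ofReal hgi (Eventually.of_forall hg0),
    ← ofReal_integral_eq_lintegral_ofReal hhi (Eventually.of_forall hh0),
    ← ENNReal.ofReal_mul ht0.le, ← ENNReal.ofReal_mul hs.le,
    ← ENNReal.ofReal_add (mul_nonneg ht0.le (integral_nonneg hf0))
      (mul_nonneg hs.le (integral_nonneg hg0)),
    ENNReal.ofReal_le_ofReal_iff (integral_nonneg hh0)] at key
  exact key

/-- The Prékopa-Leindler inequality on the line for quasi-concave functions. -/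
lemma integral_rpow_mul_integral_rpow_le {f g h : ℝ → ℝ} {t C R : ℝ} (ht0 : 0 < t) (ht1 : t < 1)
    (hf : Measurable f) (hg : Measurable g) (hh : Measurable h)
    (hf0 : ∀ x, 0 ≤ f x) (hg0 : ∀ x, 0 ≤ g x) (hh0 : ∀ x, 0 ≤ h x)
    (hfC : ∀ x, f x ≤ C) (hgC : ∀ x, g x ≤ C) (hhC : ∀ x, h x ≤ C)
    (hfR : ∀ x, R < |x| → f x = 0) (hgR : ∀ x, R < |x| → g x = 0) (hhR : ∀ x, R < |x| → h x = 0)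
    (hfc : ∀ c, 0 < c → Convex ℝ {x | c < f x}) (hgc : ∀ c, 0 < c → Convex ℝ {x | c < g x})
    (hfgh : ∀ x y, f x ^ t * g y ^ (1 - t) ≤ h (t * x + (1 - t) * y)) :
    (∫ x, f x) ^ t * (∫ x, g x) ^ (1 - t) ≤ ∫ x, h x := by
  have hs : 0 < 1 - t := by linarith
  have hsup : ∀ k : ℝ → ℝ, (∀ x, 0 ≤ k x) → (∀ x, k x ≤ C) → (∀ x, k x ≤ ⨆ x, k x) ∧
      0 ≤ ⨆ x, k x := fun k hk0 hk => by
    have hb : BddAbove (Set.range k) := ⟨C, by rintro _ ⟨x, rfl⟩; exact hk x⟩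
    exact ⟨fun x => le_ciSup hb x, (hk0 0).trans (le_ciSup hb 0)⟩
  obtain ⟨hF, hF0⟩ := hsup f hf0 hfC
  obtain ⟨hG, hG0⟩ := hsup g hg0 hgC
  set F := ⨆ x, f x with hFdef
  set G := ⨆ x, g x with hGdef
  rcases hF0.eq_or_lt with hFz | hF0
  · have : ∀ x, f x = 0 := fun x => le_antisymm ((hF x).trans hFz.symm.le) (hf0 x)
    simp only [this, integral_zero, Real.zero_rpow ht0.ne', zero_mul]
    exact integral_nonneg hh0
  rcases hG0.eq_or_lt with hGz | hG0
  · have : ∀ x, g x = 0 := fun x => le_antisymm ((hG x).trans hGz.symm.le) (hg0 x)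
    simp only [this, integral_zero, Real.zero_rpow hs.ne', mul_zero]
    exact integral_nonneg hh0
  set K := F ^ t * G ^ (1 - t) with hK
  have hK0 : 0 < K := by positivity
  have hnorm := mul_integral_add_le_of_normalized (f := fun x => f x / F) (g := fun x => g x / G)
    (h := fun x => h x / K) (C := C / K) (R := R) ht0 ht1 (hf.div_const _) (hg.div_const _)
    (hh.div_const _) (fun x => div_nonneg (hf0 x) hF0.le) (fun x => div_nonneg (hg0 x) hG0.le)
    (fun x => div_nonneg (hh0 x) hK0.le) (fun x => (div_le_one hF0).2 (hF x))
    (fun x => (div_le_one hG0).2 (hG x)) (fun x => by gcongr; exact hhC x)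
    (fun x hx => by simp [hfR x hx]) (fun x hx => by simp [hgR x hx])
    (fun x hx => by simp [hhR x hx])
    (fun c hc => by simp_rw [lt_div_iff₀ hF0]; exact hfc _ (by positivity))
    (fun c hc => by simp_rw [lt_div_iff₀ hG0]; exact hgc _ (by positivity))
    (fun c hc => by
      simp_rw [lt_div_iff₀ hF0]
      exact exists_lt_of_lt_ciSup (by rw [← hFdef]; nlinarith))
    (fun c hc => by
      simp_rw [lt_div_iff₀ hG0]
      exact exists_lt_of_lt_ciSup (by rw [← hGdef]; nlinarith))
    (fun x y => by
      rw [Real.div_rpow (hf0 x) hF0.le, Real.div_rpow (hg0 y) hG0.le, div_mul_div_comm]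
      exact div_le_div_of_nonneg_right (hfgh x y) hK0.le)
  simp only [integral_div] at hnorm
  have ham := Real.geom_mean_le_arith_mean2_weighted ht0.le hs.le
    (div_nonneg (integral_nonneg hf0) hF0.le : 0 ≤ (∫ x, f x) / F)
    (div_nonneg (integral_nonneg hg0) hG0.le : 0 ≤ (∫ x, g x) / G) (by ring)
  rw [Real.div_rpow (integral_nonneg hf0) hF0.le, Real.div_rpow (integral_nonneg hg0) hG0.le,
    div_mul_div_comm] at ham
  exact (div_le_div_iff_of_pos_right hK0).1 (ham.trans hnorm)

end PrekopaLine

section Prekopa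

/-- Multiplicative log-concavity. -/
def IsLogConcave {V : Type*} [AddCommGroup V] [Module ℝ V] (f : V → ℝ) : Prop :=
  ∀ x y (t : ℝ), 0 < t → t < 1 → f x ^ t * f y ^ (1 - t) ≤ f (t • x + (1 - t) • y)

lemma IsLogConcave.comp_affine {V V' : Type*} [AddCommGroup V] [Module ℝ V] [AddCommGroup V']
    [Module ℝ V'] {f : V → ℝ} (hf : IsLogConcave f) {g : V' → V}
    (hg : ∀ x y (t : ℝ), g (t • x + (1 - t) • y) = t • g x + (1 - t) • g y) :
    IsLogConcave fun x => f (g x) := fun x y t ht0 ht1 => by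
  simpa only [hg] using hf (g x) (g y) t ht0 ht1

lemma IsLogConcave.convex_lt {V : Type*} [AddCommGroup V] [Module ℝ V] {f : V → ℝ}
    (hf : IsLogConcave f) {c : ℝ} (hc : 0 < c) : Convex ℝ {x | c < f x} := by
  rw [convex_iff_forall_pos]
  intro x hx y hy a b ha hb hab
  have hx : c < f x := hx
  have hy : c < f y := hy
  obtain rfl : b = 1 - a := by linarith
  calc c = c ^ a * c ^ (1 - a) := by rw [← Real.rpow_add hc]; simp
    _ < f x ^ a * f y ^ (1 - a) :=
      mul_lt_mul'' (Real.rpow_lt_rpow hc.le hx ha) (Real.rpow_lt_rpow hc.le hy hb)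
        (by positivity) (by positivity)
    _ ≤ _ := hf x y a ha (by linarith)

lemma IsLogConcave.mul {V : Type*} [AddCommGroup V] [Module ℝ V] {f g : V → ℝ}
    (hf : IsLogConcave f) (hg : IsLogConcave g) (hf0 : ∀ x, 0 ≤ f x) (hg0 : ∀ x, 0 ≤ g x) :
    IsLogConcave fun x => f x * g x := fun x y t ht0 ht1 => by
  rw [Real.mul_rpow (hf0 x) (hg0 x), Real.mul_rpow (hf0 y) (hg0 y), mul_mul_mul_comm]
  exact mul_le_mul (hf x y t ht0 ht1) (hg x y t ht0 ht1)
    (mul_nonneg (Real.rpow_nonneg (hg0 _) _) (Real.rpow_nonneg (hg0 _) _)) (hf0 _)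

lemma IsLogConcave.indicator {V : Type*} [AddCommGroup V] [Module ℝ V] {f : V → ℝ} {s : Set V}
    (hs : Convex ℝ s)
    (hf : ∀ x ∈ s, ∀ y ∈ s, ∀ t : ℝ, 0 < t → t < 1 →
      f x ^ t * f y ^ (1 - t) ≤ f (t • x + (1 - t) • y)) (hf0 : ∀ x ∈ s, 0 ≤ f x) :
    IsLogConcave (s.indicator f) := fun x y t ht0 ht1 => by
  have hs1 : 0 < 1 - t := by linarith
  have h0 : 0 ≤ s.indicator f (t • x + (1 - t) • y) := Set.indicator_nonneg hf0 _
  by_cases hx : x ∈ s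
  · by_cases hy : y ∈ s
    · rw [Set.indicator_of_mem hx, Set.indicator_of_mem hy,
        Set.indicator_of_mem (hs hx hy ht0.le hs1.le (by ring))]
      exact hf x hx y hy t ht0 ht1
    · simpa [Set.indicator_of_notMem hy, Real.zero_rpow hs1.ne'] using h0
  · simpa [Set.indicator_of_notMem hx, Real.zero_rpow ht0.ne'] using h0

lemma IsLogConcave.min_mul_exp_le {f : ℝ → ℝ} (hf : IsLogConcave f) (hf0 : ∀ x, 0 ≤ f x)
    (s x y z : ℝ) (hxy : x ≤ y) (hyz : y ≤ z) :
    min (f x * Real.exp (-(s * x))) (f z * Real.exp (-(s * z))) ≤ f y * Real.exp (-(s * y)) := by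
  by_contra! hlt
  have hexp : IsLogConcave fun x : ℝ => Real.exp (-(s * x)) := fun x y t _ _ => by
    rw [← Real.exp_mul, ← Real.exp_mul, ← Real.exp_add]
    refine le_of_eq (congrArg _ ?_)
    simp only [smul_eq_mul]; ring
  have hprod := hf.mul hexp hf0 fun x => (Real.exp_pos _).le
  have hmax : 0 ≤ f y * Real.exp (-(s * y)) := mul_nonneg (hf0 _) (Real.exp_pos _).le
  obtain ⟨c, hc1, hc2⟩ := exists_between hlt
  have hconv := hprod.convex_lt (hmax.trans_lt hc1)
  have hy := hconv.ordConnected.out (hc2.trans_le (min_le_left _ _))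
    (hc2.trans_le (min_le_right _ _)) ⟨hxy, hyz⟩
  exact hc1.not_ge (le_of_lt hy)

lemma isLogConcave_integral_real {V : Type*} [AddCommGroup V] [Module ℝ V] {F : V → ℝ → ℝ}
    {C R : ℝ} (hF : IsLogConcave fun z : V × ℝ => F z.1 z.2) (hFm : ∀ v, Measurable (F v))
    (hF0 : ∀ v x, 0 ≤ F v x) (hFC : ∀ v x, F v x ≤ C) (hFR : ∀ v x, R < |x| → F v x = 0) :
    IsLogConcave fun v => ∫ x, F v x := fun v₁ v₂ t ht0 ht1 => by
  have hconv : ∀ v c, 0 < c → Convex ℝ {x | c < F v x} := fun v c hc => by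
    refine IsLogConcave.convex_lt (f := F v) ?_ hc
    refine hF.comp_affine (g := fun x : ℝ => (v, x)) fun x y t => ?_
    ext
    · simp [← add_smul]
    · simp
  exact integral_rpow_mul_integral_rpow_le ht0 ht1 (hFm _) (hFm _) (hFm _) (hF0 _) (hF0 _) (hF0 _)
    (hFC _) (hFC _) (hFC _) (hFR _) (hFR _) (hFR _) (hconv _) (hconv _)
    fun x y => hF (v₁, x) (v₂, y) t ht0 ht1

lemma integrable_pi_of_bounded_support {m : ℕ} {f : (Fin m → ℝ) → ℝ} {C R : ℝ} (hf : Measurable f)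
    (hf0 : ∀ x, 0 ≤ f x) (hfC : ∀ x, f x ≤ C) (hfR : ∀ x, (∃ i, R < |x i|) → f x = 0) :
    Integrable f ∧ ∫ x, f x ≤ C * volume.real (Set.Icc (fun _ : Fin m => -R) fun _ => R) := by
  set S := Set.Icc (fun _ : Fin m => -R) fun _ => R
  have hS : volume S ≠ ⊤ := (isCompact_Icc).measure_lt_top.ne
  have h1 : f = S.indicator f := by
    ext x
    by_cases hx : x ∈ S
    · rw [Set.indicator_of_mem hx]
    · rw [Set.indicator_of_notMem hx, hfR x]
      by_contra! h
      exact hx ⟨fun i => (abs_le.1 (h i)).1, fun i => (abs_le.1 (h i)).2⟩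
  have hint : IntegrableOn f S := Measure.integrableOn_of_bounded (M := C) hS
    hf.aestronglyMeasurable (Eventually.of_forall fun x => by
      rw [Real.norm_of_nonneg (hf0 x)]; exact hfC x)
  refine ⟨by rw [h1, integrable_indicator_iff measurableSet_Icc]; exact hint, ?_⟩
  rw [h1, integral_indicator measurableSet_Icc, mul_comm, ← smul_eq_mul, ← setIntegral_const]
  exact setIntegral_mono_on hint (integrableOn_const hS) measurableSet_Icc fun x _ => hfC x

lemma integral_eq_integral_integral_insertNth {m : ℕ} {f : (Fin (m + 1) → ℝ) → ℝ}
    (k : Fin (m + 1)) (hf : Integrable f) :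
    ∫ x, f x = ∫ a : ℝ, ∫ y : Fin m → ℝ, f (k.insertNth a y) := by
  have he := (volume_preserving_piFinSuccAbove (fun _ : Fin (m + 1) => ℝ) k).symm
  rw [← he.integral_comp' (g := f), Measure.volume_eq_prod, integral_prod]
  · rfl
  · exact he.integrable_comp_emb (MeasurableEquiv.measurableEmbedding _) |>.2 hf

lemma measurable_insertNth {m : ℕ} (k : Fin (m + 1)) :
    Measurable fun z : ℝ × (Fin m → ℝ) => (k.insertNth z.1 z.2 : Fin (m + 1) → ℝ) :=
  (MeasurableEquiv.piFinSuccAbove (fun _ : Fin (m + 1) => ℝ) k).symm.measurable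

lemma insertNth_smul_add_smul {m : ℕ} (k : Fin (m + 1)) (a b t s : ℝ) (x y : Fin m → ℝ) :
    (k.insertNth (t * a + s * b) (t • x + s • y) : Fin (m + 1) → ℝ)
      = t • (k.insertNth a x : Fin (m + 1) → ℝ) + s • (k.insertNth b y : Fin (m + 1) → ℝ) := by
  ext j
  refine Fin.succAboveCases k ?_ (fun i => ?_) j <;> simp

/-- Prékopa's theorem: marginals of log-concave functions are log-concave. -/
lemma isLogConcave_integral {m : ℕ} : ∀ {V : Type} [AddCommGroup V] [Module ℝ V]
    {F : V → (Fin m → ℝ) → ℝ} {C R : ℝ} (_ : IsLogConcave fun z : V × (Fin m → ℝ) => F z.1 z.2)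
    (_ : ∀ v, Measurable (F v)) (_ : ∀ v x, 0 ≤ F v x) (_ : ∀ v x, F v x ≤ C)
    (_ : ∀ v x, (∃ i, R < |x i|) → F v x = 0), IsLogConcave fun v => ∫ x, F v x := by
  induction m with
  | zero =>
    intro V _ _ F C R hF hFm hF0 hFC hFR
    have h : ∀ v, ∫ x, F v x = F v default := fun v => by
      rw [integral_unique]; simp [Measure.real, volume_pi]
      exact congrArg _ (Subsingleton.elim _ _)
    simp only [h]
    refine hF.comp_affine (g := fun v : V => (v, default)) fun x y t => ?_
    ext
    · simp
    · rename_i i; exact i.elim0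
  | succ m ih =>
    intro V _ _ F C R hF hFm hF0 hFC hFR
    have hint := fun v => integrable_pi_of_bounded_support (hFm v) (hF0 v) (hFC v) (hFR v)
    simp only [fun v => integral_eq_integral_integral_insertNth 0 (hint v).1]
    have hm : ∀ v, Measurable fun z : ℝ × (Fin m → ℝ) =>
        F v ((0 : Fin (m + 1)).insertNth z.1 z.2) :=
      fun v => (hFm v).comp (measurable_insertNth 0)
    have hR : ∀ v a (y : Fin m → ℝ), (∃ i, R < |y i|) →
        F v ((0 : Fin (m + 1)).insertNth a y) = 0 := by
      rintro v a y ⟨i, hi⟩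
      exact hFR v _ ⟨Fin.succAbove 0 i, by simpa only [Fin.insertNth_apply_succAbove] using hi⟩
    refine isLogConcave_integral_real
      (C := C * volume.real (Set.Icc (fun _ : Fin m => -R) fun _ => R)) (R := R) ?_ ?_ ?_ ?_ ?_
    · refine ih (V := V × ℝ) (F := fun z y => F z.1 ((0 : Fin (m + 1)).insertNth z.2 y))
        (C := C) (R := R)
        ?_ ?_ (fun _ _ => hF0 _ _) (fun _ _ => hFC _ _) (fun _ _ => hR _ _ _)
      · refine hF.comp_affine (g := fun z : (V × ℝ) × (Fin m → ℝ) =>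
          (z.1.1, ((0 : Fin (m + 1)).insertNth z.1.2 z.2 : Fin (m + 1) → ℝ))) fun x y t => ?_
        exact Prod.ext rfl (insertNth_smul_add_smul 0 _ _ _ _ _ _)
      · exact fun z => (hm z.1).comp (by fun_prop : Measurable fun y => (z.2, y))
    · exact fun v => (hm v).stronglyMeasurable.integral_prod_right.measurable
    · exact fun v a => integral_nonneg fun y => hF0 _ _
    · exact fun v a => (integrable_pi_of_bounded_support
        ((hm v).comp (by fun_prop : Measurable fun y => (a, y))) (fun y => hF0 _ _)
        (fun y => hFC _ _) fun y hy => hR v a y hy).2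
    · intro v a ha
      rw [← integral_zero (Fin m → ℝ) ℝ]
      refine integral_congr_ae (Eventually.of_forall fun y => hFR v _ ⟨0, ?_⟩)
      simpa only [Fin.insertNth_apply_same] using ha

end Prekopa

section Localization

open scoped Topology

variable {n : ℕ}

/-- The half-space bounded by the hyperplane through the codimension-two plane
`x i = q, x j = r` at angle `θ`. -/
def pencilHalfSpace (i j : Fin n) (q r θ : ℝ) : Set (EuclideanSpace ℝ (Fin n)) :=
  {x | 0 ≤ Real.cos θ * (x i - q) + Real.sin θ * (x j - r)}

lemma isClosed_pencilHalfSpace (i j : Fin n) (q r θ : ℝ) : IsClosed (pencilHalfSpace i j q r θ) :=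
  isClosed_le continuous_const (by fun_prop)

lemma convex_pencilHalfSpace (i j : Fin n) (q r θ : ℝ) : Convex ℝ (pencilHalfSpace i j q r θ) := by
  intro x hx y hy a b ha hb hab
  simp only [pencilHalfSpace, Set.mem_ofPred_eq] at *
  have h := add_nonneg (mul_nonneg ha hx) (mul_nonneg hb hy)
  simp only [PiLp.add_apply, PiLp.smul_apply, smul_eq_mul]
  obtain rfl : b = 1 - a := by linarith
  refine h.trans (le_of_eq ?_)
  ring

lemma ae_pencil_ne_zero {i j : Fin n} (hij : i ≠ j) (q r θ : ℝ) :
    ∀ᵐ x : EuclideanSpace ℝ (Fin n), Real.cos θ * (x i - q) + Real.sin θ * (x j - r) ≠ 0 := by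
  let S : AffineSubspace ℝ (EuclideanSpace ℝ (Fin n)) :=
    { carrier := {x | Real.cos θ * (x i - q) + Real.sin θ * (x j - r) = 0}
      smul_vsub_vadd_mem' := fun c x y z hx hy hz => by
        simp only [Set.mem_ofPred_eq, vsub_eq_sub, vadd_eq_add, PiLp.add_apply, PiLp.smul_apply,
          PiLp.sub_apply, smul_eq_mul] at *
        linear_combination c * hx - c * hy + hz }
  have hS : S ≠ ⊤ := by
    intro h
    have hmem : (WithLp.toLp 2 (fun l => if l = i then q + Real.cos θ else
        if l = j then r + Real.sin θ else 0) : EuclideanSpace ℝ (Fin n)) ∈ S := by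
      rw [h]; trivial
    have hmem' : Real.cos θ * (q + Real.cos θ - q) + Real.sin θ * (r + Real.sin θ - r) = 0 := by
      have h1 : _ = (0 : ℝ) := hmem
      simpa [hij.symm] using h1
    nlinarith [Real.sin_sq_add_cos_sq θ]
  have h0 := Measure.addHaar_affineSubspace volume S hS
  rw [ae_iff]
  simp only [ne_eq, not_not]
  exact h0

lemma setIntegral_pencilHalfSpace_add {i j : Fin n} (hij : i ≠ j) (q r θ : ℝ)
    {K : Set (EuclideanSpace ℝ (Fin n))} {f : EuclideanSpace ℝ (Fin n) → ℝ}
    (hf : IntegrableOn f K) :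
    (∫ x in K ∩ pencilHalfSpace i j q r θ, f x)
      + (∫ x in K ∩ pencilHalfSpace i j q r (θ + π), f x) = ∫ x in K, f x := by
  have hae : (K ∩ pencilHalfSpace i j q r (θ + π) : Set (EuclideanSpace ℝ (Fin n))) =ᵐ[volume]
      (K \ pencilHalfSpace i j q r θ : Set (EuclideanSpace ℝ (Fin n))) := by
    refine eventuallyEq_set.2 ?_
    filter_upwards [ae_pencil_ne_zero hij q r θ] with x hx
    refine and_congr_right fun _ => ?_
    change 0 ≤ Real.cos (θ + π) * (x i - q) + Real.sin (θ + π) * (x j - r)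
      ↔ ¬ (0 ≤ Real.cos θ * (x i - q) + Real.sin θ * (x j - r))
    rw [Real.cos_add_pi, Real.sin_add_pi, not_le]
    constructor
    · intro h
      exact lt_of_le_of_ne (by linarith) hx
    · intro h; linarith
  rw [setIntegral_congr_set hae]
  exact integral_inter_add_sdiff (isClosed_pencilHalfSpace i j q r θ).measurableSet hf

lemma continuous_setIntegral_pencilHalfSpace {i j : Fin n} (hij : i ≠ j) (q r : ℝ)
    {K : Set (EuclideanSpace ℝ (Fin n))} {f : EuclideanSpace ℝ (Fin n) → ℝ}
    (hf : IntegrableOn f K) :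
    Continuous fun θ => ∫ x in K ∩ pencilHalfSpace i j q r θ, f x := by
  have hrepr : ∀ θ, ∫ x in K ∩ pencilHalfSpace i j q r θ, f x
      = ∫ x in K, (pencilHalfSpace i j q r θ).indicator f x := fun θ =>
    (setIntegral_indicator (isClosed_pencilHalfSpace i j q r θ).measurableSet).symm
  simp only [hrepr]
  refine continuous_iff_continuousAt.2 fun θ₀ => ?_
  refine continuousAt_of_dominated (bound := fun x => ‖f x‖) (Eventually.of_forall fun θ =>
      (hf.indicator (isClosed_pencilHalfSpace i j q r θ).measurableSet).aestronglyMeasurable)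
    (Eventually.of_forall fun θ => Eventually.of_forall fun x => norm_indicator_le_norm_self _ _)
    hf.norm ?_
  refine ae_restrict_of_ae ?_
  filter_upwards [ae_pencil_ne_zero hij q r θ₀] with x hx
  have hc : Continuous fun θ => Real.cos θ * (x i - q) + Real.sin θ * (x j - r) := by fun_prop
  rcases hx.lt_or_gt with h | h
  · refine (continuousAt_const (y := (0 : ℝ))).congr ?_
    filter_upwards [hc.continuousAt.eventually_lt continuousAt_const h] with θ hθ
    exact (Set.indicator_of_notMem (s := pencilHalfSpace i j q r θ) (not_le.2 hθ) f).symm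
  · refine (continuousAt_const (y := f x)).congr ?_
    filter_upwards [continuousAt_const.eventually_lt hc.continuousAt h] with θ hθ
    exact (Set.indicator_of_mem (s := pencilHalfSpace i j q r θ) hθ.le f).symm

lemma exists_pencilHalfSpace_bisect {i j : Fin n} (hij : i ≠ j) (q r : ℝ)
    {K : Set (EuclideanSpace ℝ (Fin n))} {f g : EuclideanSpace ℝ (Fin n) → ℝ}
    (hf : IntegrableOn f K) (hg : IntegrableOn g K) (hf0 : ∫ x in K, f x = 0)
    (hg0 : ∫ x in K, g x < 0) :
    ∃ θ, ∫ x in K ∩ pencilHalfSpace i j q r θ, f x = 0 ∧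
      ∫ x in K ∩ pencilHalfSpace i j q r θ, g x < 0 := by
  have hsum := fun θ => setIntegral_pencilHalfSpace_add hij q r θ hf
  have hcont := continuous_setIntegral_pencilHalfSpace hij q r hf
  obtain ⟨θ, -, hθ⟩ : ∃ θ ∈ Set.uIcc 0 π, ∫ x in K ∩ pencilHalfSpace i j q r θ, f x = 0 := by
    refine intermediate_value_uIcc (a := 0) (b := π) hcont.continuousOn ?_
    have h := hsum 0
    rw [hf0, zero_add] at h
    rw [Set.mem_uIcc]
    rcases le_total 0 (∫ x in K ∩ pencilHalfSpace i j q r 0, f x) with h' | h'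
    · exact Or.inr ⟨by linarith, h'⟩
    · exact Or.inl ⟨h', by linarith⟩
  have hg' := setIntegral_pencilHalfSpace_add hij q r θ hg
  rcases lt_or_ge (∫ x in K ∩ pencilHalfSpace i j q r θ, g x) 0 with h | h
  · exact ⟨θ, hθ, h⟩
  · exact ⟨θ + π, by linarith [hsum θ], by linarith⟩

lemma minor_eq_zero_of_pencil {i j : Fin n} {S : Set (EuclideanSpace ℝ (Fin n))}
    (hS : ∀ q r : ℚ, ∃ θ, S ⊆ pencilHalfSpace i j q r θ) {a b c : EuclideanSpace ℝ (Fin n)}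
    (ha : a ∈ S) (hb : b ∈ S) (hc : c ∈ S) :
    (a i - c i) * (b j - c j) - (a j - c j) * (b i - c i) = 0 := by
  by_contra hD
  set D := (a i - c i) * (b j - c j) - (a j - c j) * (b i - c i) with hDdef
  let α : ℝ × ℝ → ℝ := fun z => ((z.1 - c i) * (b j - c j) - (z.2 - c j) * (b i - c i)) / D
  let β : ℝ × ℝ → ℝ := fun z => ((a i - c i) * (z.2 - c j) - (a j - c j) * (z.1 - c i)) / D
  have hα : Continuous α := by simp only [α]; fun_prop
  have hβ : Continuous β := by simp only [β]; fun_prop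
  have hopen : IsOpen {z | 0 < α z ∧ 0 < β z ∧ α z + β z < 1} :=
    (isOpen_lt continuous_const hα).inter
      ((isOpen_lt continuous_const hβ).inter (isOpen_lt (hα.add hβ) continuous_const))
  have hne : {z | 0 < α z ∧ 0 < β z ∧ α z + β z < 1}.Nonempty := by
    refine ⟨((a i + b i + c i) / 3, (a j + b j + c j) / 3), ?_⟩
    have h1 : α ((a i + b i + c i) / 3, (a j + b j + c j) / 3) = 1 / 3 := by
      simp only [α]; rw [div_eq_iff hD]; rw [hDdef]; ring
    have h2 : β ((a i + b i + c i) / 3, (a j + b j + c j) / 3) = 1 / 3 := by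
      simp only [β]; rw [div_eq_iff hD]; rw [hDdef]; ring
    simp only [Set.mem_ofPred_eq, h1, h2]
    norm_num
  obtain ⟨⟨q, r⟩, h1, h2, h3⟩ :=
    (Rat.denseRange_cast (𝕜 := ℝ).prodMap (Rat.denseRange_cast (𝕜 := ℝ))).exists_mem_open hopen hne
  simp only [Prod.map_apply] at h1 h2 h3
  obtain ⟨θ, hθ⟩ := hS q r
  set A := α (q, r) with hA
  set B := β (q, r) with hB
  have hq : (q : ℝ) = c i + A * (a i - c i) + B * (b i - c i) := by
    simp only [hA, hB, α, β]; field_simp; rw [hDdef]; ring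
  have hr : (r : ℝ) = c j + A * (a j - c j) + B * (b j - c j) := by
    simp only [hA, hB, α, β]; field_simp; rw [hDdef]; ring
  have ea : 0 ≤ Real.cos θ * (a i - q) + Real.sin θ * (a j - r) := hθ ha
  have eb : 0 ≤ Real.cos θ * (b i - q) + Real.sin θ * (b j - r) := hθ hb
  have ec : 0 ≤ Real.cos θ * (c i - q) + Real.sin θ * (c j - r) := hθ hc
  set x := Real.cos θ * (a i - q) + Real.sin θ * (a j - r) with hx
  set y := Real.cos θ * (b i - q) + Real.sin θ * (b j - r) with hy
  set z := Real.cos θ * (c i - q) + Real.sin θ * (c j - r) with hz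
  have hsum : A * x + B * y + (1 - A - B) * z = 0 := by
    rw [hx, hy, hz, hq, hr]; ring
  have h4 : 0 < 1 - A - B := by linarith
  have x0 : x = 0 := by
    by_contra h
    have := lt_of_le_of_ne ea (Ne.symm h)
    nlinarith [mul_pos h1 this, mul_nonneg h2.le eb, mul_nonneg h4.le ec]
  have y0 : y = 0 := by
    by_contra h
    have := lt_of_le_of_ne eb (Ne.symm h)
    nlinarith [mul_pos h2 this, mul_nonneg h1.le ea, mul_nonneg h4.le ec]
  have z0 : z = 0 := by
    by_contra h
    have := lt_of_le_of_ne ec (Ne.symm h)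
    nlinarith [mul_pos h4 this, mul_nonneg h1.le ea, mul_nonneg h2.le eb]
  have e1 : Real.cos θ * (a i - c i) + Real.sin θ * (a j - c j) = 0 := by
    linear_combination x0 - z0
  have e2 : Real.cos θ * (b i - c i) + Real.sin θ * (b j - c j) = 0 := by
    linear_combination y0 - z0
  have hcos : Real.cos θ * D = 0 := by
    rw [hDdef]; linear_combination (b j - c j) * e1 - (a j - c j) * e2
  have hsin : Real.sin θ * D = 0 := by
    rw [hDdef]; linear_combination (a i - c i) * e2 - (b i - c i) * e1
  have hcos0 := (mul_eq_zero.1 hcos).resolve_right hD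
  have hsin0 := (mul_eq_zero.1 hsin).resolve_right hD
  have := Real.sin_sq_add_cos_sq θ
  rw [hcos0, hsin0] at this
  norm_num at this

lemma exists_line_of_minors_eq_zero (hn : 0 < n) {S : Set (EuclideanSpace ℝ (Fin n))}
    (hS : ∀ i j : Fin n, i ≠ j → ∀ a ∈ S, ∀ b ∈ S, ∀ c ∈ S,
      (a i - c i) * (b j - c j) - (a j - c j) * (b i - c i) = 0) :
    ∃ (a e : EuclideanSpace ℝ (Fin n)) (k : Fin n), ‖e‖ = 1 ∧ e k ≠ 0 ∧
      ∀ x ∈ S, a + ((x k - a k) / e k) • e = x := by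
  rcases S.subsingleton_or_nontrivial with hsub | ⟨a, ha, b, hb, hab⟩
  · obtain ⟨a, hSa⟩ : ∃ a, S ⊆ {a} := by
      rcases hsub.eq_empty_or_singleton with h | ⟨a, h⟩
      · exact ⟨0, by simp [h]⟩
      · exact ⟨a, h.le⟩
    refine ⟨a, EuclideanSpace.single ⟨0, hn⟩ 1, ⟨0, hn⟩, by simp, by simp, fun x hx => ?_⟩
    rw [hSa hx]; simp
  · have hne : b - a ≠ 0 := sub_ne_zero.2 hab.symm
    have hnorm : 0 < ‖b - a‖ := norm_pos_iff.2 hne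
    obtain ⟨k, hk⟩ : ∃ k, (b - a) k ≠ 0 := by
      by_contra! h
      exact hne (by ext k; simpa using h k)
    refine ⟨a, (‖b - a‖⁻¹) • (b - a), k, ?_, ?_, fun x hx => ?_⟩
    · rw [norm_smul, norm_inv, norm_norm, inv_mul_cancel₀ hnorm.ne']
    · simp only [PiLp.smul_apply, smul_eq_mul]
      exact mul_ne_zero (inv_ne_zero hnorm.ne') hk
    · rw [smul_smul]
      ext l
      simp only [PiLp.add_apply, PiLp.smul_apply, PiLp.sub_apply, smul_eq_mul] at hk ⊢
      have key : (x k - a k) * (b l - a l) = (x l - a l) * (b k - a k) := by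
        by_cases hkl : k = l
        · rw [hkl]
        · linarith [hS k l hkl x hx b hb a ha]
      field_simp
      linarith

/-- Localization: a compact convex set can be cut down to a segment along convex subsets on which
`f` has vanishing integral and `g` has negative integral. -/
theorem exists_needle (hn : 2 ≤ n) {K₀ : Set (EuclideanSpace ℝ (Fin n))} (hK₀ : IsCompact K₀)
    (hK₀c : Convex ℝ K₀) {f g : EuclideanSpace ℝ (Fin n) → ℝ} (hf : IntegrableOn f K₀)
    (hg : IntegrableOn g K₀) (hf0 : ∫ x in K₀, f x = 0) (hg0 : ∫ x in K₀, g x < 0) :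
    ∃ K : ℕ → Set (EuclideanSpace ℝ (Fin n)), Antitone K ∧
      (∀ m, IsCompact (K m) ∧ Convex ℝ (K m) ∧ K m ⊆ K₀ ∧ ∫ x in K m, f x = 0 ∧
        ∫ x in K m, g x < 0) ∧
      ∃ (a e : EuclideanSpace ℝ (Fin n)) (k : Fin n), ‖e‖ = 1 ∧ e k ≠ 0 ∧
        ∀ x ∈ ⋂ m, K m, a + ((x k - a k) / e k) • e = x := by
  let P : Set (EuclideanSpace ℝ (Fin n)) → Prop := fun K => IsCompact K ∧ Convex ℝ K ∧ K ⊆ K₀ ∧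
    ∫ x in K, f x = 0 ∧ ∫ x in K, g x < 0
  let T := {z : (Fin n × Fin n) × (ℚ × ℚ) // z.1.1 ≠ z.1.2}
  have hstep : ∀ (K : {K // P K}) (z : T), ∃ K' : {K // P K}, K'.1 ⊆ K.1 ∧
      ∃ θ, K'.1 ⊆ pencilHalfSpace z.1.1.1 z.1.1.2 z.1.2.1 z.1.2.2 θ := by
    rintro ⟨K, hKc, hKconv, hKsub, hKf, hKg⟩ ⟨⟨⟨i, j⟩, q, r⟩, hij⟩
    obtain ⟨θ, h1, h2⟩ := exists_pencilHalfSpace_bisect hij q r (hf.mono_set hKsub)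
      (hg.mono_set hKsub) hKf hKg
    exact ⟨⟨K ∩ pencilHalfSpace i j q r θ, hKc.inter_right (isClosed_pencilHalfSpace _ _ _ _ _),
      hKconv.inter (convex_pencilHalfSpace _ _ _ _ _), Set.inter_subset_left.trans hKsub, h1, h2⟩,
      Set.inter_subset_left, θ, Set.inter_subset_right⟩
  choose next hnext hθ using hstep
  have : Nonempty T := ⟨⟨((⟨0, by omega⟩, ⟨1, by omega⟩), (0, 0)), by simp⟩⟩
  obtain ⟨z, hz⟩ := exists_surjective_nat T
  let K : ℕ → {K // P K} := fun m => Nat.rec ⟨K₀, hK₀, hK₀c, le_rfl, hf0, hg0⟩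
    (fun m K => next K (z m)) m
  refine ⟨fun m => (K m).1, antitone_nat_of_succ_le fun m => hnext (K m) (z m), fun m => (K m).2,
    exists_line_of_minors_eq_zero (by omega) fun i j hij a ha b hb c hc =>
      minor_eq_zero_of_pencil (fun q r => ?_) ha hb hc⟩
  obtain ⟨m, hm⟩ := hz ⟨((i, j), (q, r)), hij⟩
  obtain ⟨θ, h⟩ := hθ (K m) (z m)
  rw [hm] at h
  exact ⟨θ, (Set.iInter_subset _ (m + 1)).trans (by simpa only [K, hm] using h)⟩

end Localization

section Marginal

lemma exists_marginal {m : ℕ} (k : Fin (m + 1)) {f : EuclideanSpace ℝ (Fin (m + 1)) → ℝ} {C R : ℝ}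
    (hf : Measurable f) (hf0 : ∀ x, 0 ≤ f x) (hfC : ∀ x, f x ≤ C)
    (hfR : ∀ x, R < ‖x‖ → f x = 0) (hflc : IsLogConcave f) :
    ∃ (W : ℝ → ℝ) (C' : ℝ), Measurable W ∧ (∀ τ, 0 ≤ W τ) ∧ (∀ τ, W τ ≤ C') ∧ IsLogConcave W ∧
      (∀ τ, (∀ x, x k = τ → f x = 0) → W τ = 0) ∧
      ∀ (φ : ℝ → ℝ) (D : ℝ), Continuous φ → (∀ τ, |φ τ| ≤ D) →
        ∫ x, φ (x k) * f x = ∫ τ, φ τ * W τ := by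
  let g : (Fin (m + 1) → ℝ) → ℝ := fun y => f (WithLp.toLp 2 y)
  have hto : Measurable fun y : Fin (m + 1) → ℝ =>
      (WithLp.toLp 2 y : EuclideanSpace ℝ (Fin (m + 1))) :=
    (PiLp.volume_preserving_toLp (Fin (m + 1))).measurable
  have hgm : Measurable g := hf.comp hto
  have hgR : ∀ y, (∃ i, R < |y i|) → g y = 0 := by
    rintro y ⟨i, hi⟩
    refine hfR _ (hi.trans_le ?_)
    exact PiLp.norm_apply_le (WithLp.toLp 2 y : EuclideanSpace ℝ (Fin (m + 1))) i
  have hgi := integrable_pi_of_bounded_support hgm (fun _ => hf0 _) (fun _ => hfC _) hgR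
  have hFm : Measurable fun z : ℝ × (Fin m → ℝ) => g (k.insertNth z.1 z.2) :=
    hgm.comp (measurable_insertNth k)
  have hFm' : ∀ τ, Measurable fun y : Fin m → ℝ => g (k.insertNth τ y) := fun τ =>
    hFm.comp (by fun_prop : Measurable fun y : Fin m → ℝ => (τ, y))
  have hFR : ∀ τ (y : Fin m → ℝ), (∃ i, R < |y i|) → g (k.insertNth τ y) = 0 := by
    rintro τ y ⟨i, hi⟩
    exact hgR _ ⟨k.succAbove i, by simpa only [Fin.insertNth_apply_succAbove] using hi⟩
  have hlc : IsLogConcave fun z : ℝ × (Fin m → ℝ) => g (k.insertNth z.1 z.2) := by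
    refine hflc.comp_affine (g := fun z : ℝ × (Fin m → ℝ) =>
      (WithLp.toLp 2 (k.insertNth z.1 z.2) : EuclideanSpace ℝ (Fin (m + 1)))) fun x y t => ?_
    rw [← WithLp.toLp_smul, ← WithLp.toLp_smul, ← WithLp.toLp_add]
    exact congrArg _ (insertNth_smul_add_smul k _ _ _ _ _ _)
  refine ⟨fun τ => ∫ y : Fin m → ℝ, g (k.insertNth τ y),
    C * volume.real (Set.Icc (fun _ : Fin m => -R) fun _ => R),
    hFm.stronglyMeasurable.integral_prod_right.measurable,
    fun τ => integral_nonneg fun y => hf0 _,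
    fun τ => (integrable_pi_of_bounded_support (hFm' τ) (fun _ => hf0 _) (fun _ => hfC _)
      (hFR τ)).2,
    isLogConcave_integral (V := ℝ) (F := fun τ (y : Fin m → ℝ) => g (k.insertNth τ y)) (C := C)
      (R := R) hlc hFm' (fun _ _ => hf0 _) (fun _ _ => hfC _) hFR, fun τ hτ => ?_,
    fun φ D hφ hD => ?_⟩
  · rw [← integral_zero (Fin m → ℝ) ℝ]
    exact integral_congr_ae (Eventually.of_forall fun y => hτ _ (by simp))
  · have h1 : ∫ x : EuclideanSpace ℝ (Fin (m + 1)), φ (x k) * f x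
        = ∫ y : Fin (m + 1) → ℝ, φ (y k) * g y := by
      rw [← (PiLp.volume_preserving_toLp (Fin (m + 1))).integral_comp
        (MeasurableEquiv.toLp 2 (Fin (m + 1) → ℝ)).measurableEmbedding]
    have h2 : Integrable fun y : Fin (m + 1) → ℝ => φ (y k) * g y :=
      hgi.1.bdd_mul (c := D) (hφ.comp (continuous_apply k)).aestronglyMeasurable
        (Eventually.of_forall fun y => hD _)
    rw [h1, integral_eq_integral_integral_insertNth k h2]
    simp only [Fin.insertNth_apply_same, integral_const_mul]

/-- One-dimensional Poincaré inequality for the marginal of a log-concave weight, transported to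
a line. -/
lemma exists_integral_comp_line_le {m : ℕ} {p μ L C M : ℝ} (hp : 2 ≤ p) (hμ : 0 < μ)
    (hL : μ ^ (1 / p) * L < piP p) {K : Set (EuclideanSpace ℝ (Fin (m + 1)))}
    (hK : IsCompact K) (hKne : K.Nonempty)
    {f : EuclideanSpace ℝ (Fin (m + 1)) → ℝ} (hf : Measurable f) (hf0 : ∀ x, 0 ≤ f x)
    (hfC : ∀ x, f x ≤ C) (hfK : ∀ x ∉ K, f x = 0) (hflc : IsLogConcave f)
    {v : EuclideanSpace ℝ (Fin (m + 1)) → ℝ} (hv : ContDiff ℝ 1 v) (hvM : ∀ x, |v x| ≤ M)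
    (hvM' : ∀ x, ‖fderiv ℝ v x‖ ≤ M) (a e : EuclideanSpace ℝ (Fin (m + 1))) (k : Fin (m + 1))
    (he : ‖e‖ = 1) (hek : e k ≠ 0)
    (hKL : ∀ x ∈ K, ∀ y ∈ K, |x k - y k| ≤ |e k| * L) :
    ∃ c, |c| ≤ M ∧ μ * ∫ x, |v (a + ((x k - a k) / e k) • e) - c| ^ p * f x
      ≤ ∫ x, ‖fderiv ℝ v (a + ((x k - a k) / e k) • e)‖ ^ p * f x := by
  have hp0 : 0 < p := by linarith
  have hM0 : 0 ≤ M := (abs_nonneg _).trans (hvM 0)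
  have hek0 : 0 < |e k| := abs_pos.2 hek
  obtain ⟨R, hR⟩ := hK.isBounded.exists_norm_le
  obtain ⟨W, C', hWm, hW0, hWC, hWlc, hWs, hWint⟩ := exists_marginal k hf hf0 hfC
    (fun x hx => hfK x fun h => (hR x h).not_gt hx) hflc
  have hck : ContinuousOn (fun x : EuclideanSpace ℝ (Fin (m + 1)) => x k) K := by fun_prop
  obtain ⟨xα, hxα, hα⟩ := hK.exists_isMinOn hKne hck
  obtain ⟨xβ, hxβ, hβ⟩ := hK.exists_isMaxOn hKne hck
  set α := xα k with hαdef
  set β := xβ k with hβdef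
  have hαβ : α ≤ β := hα hxβ
  let ℓ : ℝ → EuclideanSpace ℝ (Fin (m + 1)) := fun τ => a + ((τ - a k) / e k) • e
  have hℓ : ∀ τ, HasDerivAt ℓ ((1 / e k) • e) τ := fun τ => by
    have h1 : HasDerivAt (fun τ : ℝ => (τ - a k) / e k) (1 / e k) τ :=
      ((hasDerivAt_id τ).sub_const _).div_const _
    exact (h1.smul_const e).const_add a
  have hℓc : Continuous ℓ := continuous_iff_continuousAt.2 fun τ => (hℓ τ).continuousAt
  let V : ℝ → ℝ := fun τ => v (ℓ τ)
  let V' : ℝ → ℝ := fun τ => fderiv ℝ v (ℓ τ) ((1 / e k) • e)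
  have hV : ∀ τ, HasDerivAt V (V' τ) τ := fun τ =>
    ((hv.differentiable one_ne_zero (ℓ τ)).hasFDerivAt).comp_hasDerivAt τ (hℓ τ)
  have hfd : Continuous fun τ => fderiv ℝ v (ℓ τ) := (hv.continuous_fderiv one_ne_zero).comp hℓc
  have hV' : Continuous V' := hfd.clm_apply continuous_const
  have hVc : Continuous V := hv.continuous.comp hℓc
  have hμ' : 0 < μ / |e k| ^ p := by positivity
  obtain ⟨τ₀, -, hτ₀⟩ := exists_setIntegral_abs_sub_rpow_le (a := α) (b := β) hαβ hp hμ'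
    (by
      rw [Real.div_rpow hμ.le (by positivity), ← Real.rpow_mul hek0.le,
        mul_one_div_cancel hp0.ne', Real.rpow_one]
      refine lt_of_le_of_lt ?_ hL
      rw [div_mul_eq_mul_div, div_le_iff₀ hek0, mul_assoc]
      refine mul_le_mul_of_nonneg_left ?_ (by positivity)
      have := hKL xβ hxβ xα hxα
      rw [mul_comm L]
      exact (le_abs_self _).trans this)
    hWm hW0 hWC (hWlc.min_mul_exp_le hW0)
  have h1D := hτ₀ V V' hV hV'
  have hWz : ∀ τ, τ ∉ Set.Icc α β → W τ = 0 := fun τ hτ => hWs τ fun x hx => hfK x fun hxK =>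
    hτ (hx ▸ ⟨hα hxK, hβ hxK⟩)
  have hto : ∀ (φ : ℝ → ℝ) (D : ℝ), Continuous φ → (∀ τ, |φ τ| ≤ D) →
      ∫ x, φ (x k) * f x = ∫ τ in Set.Ioc α β, φ τ * W τ := fun φ D hφ hD => by
    rw [hWint φ D hφ hD, ← integral_Icc_eq_integral_Ioc]
    refine (setIntegral_eq_integral_of_forall_compl_eq_zero fun τ hτ => ?_).symm
    rw [hWz τ hτ, mul_zero]
  refine ⟨V τ₀, hvM _, ?_⟩
  have hcont1 : Continuous fun τ => |V τ - V τ₀| ^ p :=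
    (hVc.sub continuous_const).abs.rpow_const fun _ => Or.inr hp0.le
  have hcont2 : Continuous fun τ => ‖fderiv ℝ v (ℓ τ)‖ ^ p :=
    hfd.norm.rpow_const fun _ => Or.inr hp0.le
  have e1 := hto (fun τ => |V τ - V τ₀| ^ p) ((M + M) ^ p) hcont1 fun τ => by
    rw [abs_of_nonneg (by positivity)]
    refine Real.rpow_le_rpow (abs_nonneg _) ((abs_sub _ _).trans ?_) hp0.le
    exact add_le_add (hvM _) (hvM _)
  have e2 := hto (fun τ => ‖fderiv ℝ v (ℓ τ)‖ ^ p) (M ^ p) hcont2 fun τ => by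
    rw [abs_of_nonneg (by positivity)]
    exact Real.rpow_le_rpow (norm_nonneg _) (hvM' _) hp0.le
  have hV'le : ∀ τ, |V' τ| ^ p ≤ ‖fderiv ℝ v (ℓ τ)‖ ^ p / |e k| ^ p := fun τ => by
    rw [← Real.div_rpow (norm_nonneg _) hek0.le]
    refine Real.rpow_le_rpow (abs_nonneg _) ?_ hp0.le
    refine ((fderiv ℝ v (ℓ τ)).le_opNorm _).trans (le_of_eq ?_)
    rw [norm_smul, he, mul_one, norm_div, norm_one, Real.norm_eq_abs, mul_one_div]
  have hint : ∀ φ : ℝ → ℝ, Continuous φ → IntegrableOn (fun x => φ x * W x) (Set.Ioc α β) := by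
    intro φ hφ
    refine Integrable.mul_bdd ((hφ.integrableOn_Icc).mono_set Set.Ioc_subset_Icc_self)
      hWm.aestronglyMeasurable (c := C') (Eventually.of_forall fun x => ?_)
    rw [Real.norm_of_nonneg (hW0 x)]; exact hWC x
  have h2 : ∫ τ in Set.Ioc α β, |V' τ| ^ p * W τ
      ≤ ∫ τ in Set.Ioc α β, ‖fderiv ℝ v (ℓ τ)‖ ^ p / |e k| ^ p * W τ := by
    refine setIntegral_mono (hint _ (hV'.abs.rpow_const fun _ => Or.inr hp0.le))
      (hint _ (hcont2.div_const _)) fun τ => ?_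
    exact mul_le_mul_of_nonneg_right (hV'le τ) (hW0 τ)
  simp only [div_mul_eq_mul_div, integral_div] at h2
  have h3 := h1D.trans h2
  rw [div_mul_eq_mul_div, div_le_div_iff_of_pos_right (by positivity)] at h3
  rw [← e1, ← e2] at h3
  exact h3

end Marginal

section WeightedPoincare

/-- The weighted `L^p` Poincaré inequality with log-concave weight on a compact convex set. -/
theorem setIntegral_abs_rpow_le_of_setIntegral_eq_zero {m : ℕ} (hm : 1 ≤ m) {p μ C M : ℝ}
    (hp : 2 ≤ p) (hμ : 0 < μ) {K₀ : Set (EuclideanSpace ℝ (Fin (m + 1)))} (hK₀ : IsCompact K₀)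
    (hK₀c : Convex ℝ K₀) (hL : μ ^ (1 / p) * Metric.diam K₀ < piP p)
    {w : EuclideanSpace ℝ (Fin (m + 1)) → ℝ} (hw : Measurable w) (hw0 : ∀ x, 0 ≤ w x)
    (hwC : ∀ x, w x ≤ C) (hwlc : IsLogConcave w)
    {v : EuclideanSpace ℝ (Fin (m + 1)) → ℝ} (hv : ContDiff ℝ 1 v) (hvM : ∀ x, |v x| ≤ M)
    (hvM' : ∀ x, ‖fderiv ℝ v x‖ ≤ M) (hv0 : ∫ x in K₀, |v x| ^ (p - 2) * v x * w x = 0) :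
    μ * ∫ x in K₀, |v x| ^ p * w x ≤ ∫ x in K₀, ‖fderiv ℝ v x‖ ^ p * w x := by
  have hp0 : 0 < p := by linarith
  have hM0 : 0 ≤ M := (abs_nonneg _).trans (hvM 0)
  have hvc : Continuous v := hv.continuous
  have hfd : Continuous fun x => fderiv ℝ v x := hv.continuous_fderiv one_ne_zero
  have hvp : Continuous fun x => |v x| ^ p := hvc.abs.rpow_const fun _ => Or.inr hp0.le
  have hvp2 : Continuous fun x => |v x| ^ (p - 2) * v x :=
    (hvc.abs.rpow_const fun _ => Or.inr (by linarith)).mul hvc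
  have hfdp : Continuous fun x => ‖fderiv ℝ v x‖ ^ p := hfd.norm.rpow_const fun _ => Or.inr hp0.le
  have hint : ∀ φ : EuclideanSpace ℝ (Fin (m + 1)) → ℝ, Continuous φ → ∀ K ⊆ K₀, IsCompact K →
      IntegrableOn (fun x => φ x * w x) K := fun φ hφ K _ hK => by
    refine Integrable.mul_bdd (hφ.continuousOn.integrableOn_compact hK)
      hw.aestronglyMeasurable (c := C) (Eventually.of_forall fun x => ?_)
    rw [Real.norm_of_nonneg (hw0 x)]; exact hwC x
  have hone : ∀ K ⊆ K₀, IsCompact K → IntegrableOn w K := fun K hK hKc => by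
    simpa using hint (fun _ => 1) continuous_const K hK hKc
  by_contra! hlt
  set S := μ * (∫ x in K₀, |v x| ^ p * w x) - ∫ x in K₀, ‖fderiv ℝ v x‖ ^ p * w x with hS
  have hS0 : 0 < S := by linarith
  have hw_int : 0 ≤ ∫ x in K₀, w x := integral_nonneg hw0
  set δ := S / ((∫ x in K₀, w x) + 1) with hδ
  have hδ0 : 0 < δ := by positivity
  have hδS : δ * (∫ x in K₀, w x) < S := by
    rw [hδ, div_mul_eq_mul_div, div_lt_iff₀ (by positivity)]
    nlinarith
  have hsplit : ∀ K ⊆ K₀, IsCompact K →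
      ∫ x in K, (‖fderiv ℝ v x‖ ^ p - μ * |v x| ^ p + δ) * w x
        = (∫ x in K, ‖fderiv ℝ v x‖ ^ p * w x) - μ * (∫ x in K, |v x| ^ p * w x)
          + δ * ∫ x in K, w x := fun K hK hKc => by
    have h1 := hint _ hfdp K hK hKc
    have h2 := (hint _ hvp K hK hKc).const_mul μ
    have h3 := (hone K hK hKc).const_mul δ
    have h12 : IntegrableOn (fun x => ‖fderiv ℝ v x‖ ^ p * w x - μ * (|v x| ^ p * w x)) K :=
      h1.sub h2
    rw [← integral_const_mul, ← integral_const_mul, ← integral_sub h1 h2, ← integral_add h12 h3]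
    refine integral_congr_ae (Eventually.of_forall fun x => ?_)
    simp only
    ring
  obtain ⟨K, hKanti, hK, a, e, k, he, hek, hline⟩ := exists_needle (by omega) hK₀ hK₀c
    (hint _ hvp2 K₀ le_rfl hK₀)
    (hint (fun x => ‖fderiv ℝ v x‖ ^ p - μ * |v x| ^ p + δ) (by fun_prop) K₀ le_rfl hK₀) hv0
    (by rw [hsplit K₀ le_rfl hK₀]; linarith)
  set ε := δ / (1 + μ) with hε
  have hε0 : 0 < ε := by positivity
  obtain ⟨ρ, hρ0, hρ⟩ : ∃ ρ > 0, μ ^ (1 / p) * (Metric.diam K₀ + 2 * ρ) < piP p := by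
    have hA : 0 < μ ^ (1 / p) := by positivity
    refine ⟨(piP p - μ ^ (1 / p) * Metric.diam K₀) / (4 * μ ^ (1 / p)),
      div_pos (by linarith) (by positivity), ?_⟩
    have : μ ^ (1 / p) * (2 * ((piP p - μ ^ (1 / p) * Metric.diam K₀) / (4 * μ ^ (1 / p))))
        = (piP p - μ ^ (1 / p) * Metric.diam K₀) / 2 := by field_simp; ring
    rw [mul_add, this]
    linarith
  obtain ⟨η, hη0, hη⟩ : ∃ η > 0, ∀ s ∈ Set.Icc (-(2 * M)) (2 * M), ∀ t ∈ Set.Icc (-(2 * M)) (2 * M),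
      |s - t| < η → |(|s| ^ p) - |t| ^ p| < ε := by
    have hc : ContinuousOn (fun t : ℝ => |t| ^ p) (Set.Icc (-(2 * M)) (2 * M)) :=
      (continuous_abs.rpow_const fun _ => Or.inr hp0.le).continuousOn
    have := isCompact_Icc.uniformContinuousOn_of_continuous hc
    rw [Metric.uniformContinuousOn_iff] at this
    simpa only [Real.dist_eq] using this ε hε0
  let Q : EuclideanSpace ℝ (Fin (m + 1)) → EuclideanSpace ℝ (Fin (m + 1)) :=
    fun x => a + ((x k - a k) / e k) • e
  have hQ : Continuous Q := by simp only [Q]; fun_prop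
  have hfdQ : Continuous fun x => ‖fderiv ℝ v (Q x)‖ ^ p := hfdp.comp hQ
  have hopen : IsOpen {x | ‖Q x - x‖ < ρ ∧ |v (Q x) - v x| < η ∧
      |‖fderiv ℝ v (Q x)‖ ^ p - ‖fderiv ℝ v x‖ ^ p| < ε} :=
    (isOpen_lt (hQ.sub continuous_id).norm continuous_const).inter
      ((isOpen_lt ((hvc.comp hQ).sub hvc).abs continuous_const).inter
        (isOpen_lt (hfdQ.sub hfdp).abs continuous_const))
  obtain ⟨l, hl⟩ := exists_subset_nhds_of_isCompact (V := K) hKanti.directed_ge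
    (fun l => (hK l).1) (U := _) fun x hx => hopen.mem_nhds (by
      have hx' : Q x = x := hline x hx
      simp only [Set.mem_ofPred_eq, hx', sub_self, norm_zero, abs_zero]
      exact ⟨hρ0, hη0, hε0⟩)
  obtain ⟨hKc, hKconv, hKsub, hKf, hKg⟩ := hK l
  have hKne : (K l).Nonempty := by
    rw [Set.nonempty_iff_ne_empty]
    rintro h
    simp [h] at hKg
  have hKm := hKc.isClosed.measurableSet
  obtain ⟨c, hc, hneedle⟩ := exists_integral_comp_line_le hp hμ hρ hKc hKne
    (hw.indicator hKm) (fun x => Set.indicator_nonneg (fun x _ => hw0 x) x)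
    (C := C) (fun x => (Set.indicator_le_self' (fun x _ => hw0 x) x).trans (hwC x))
    (fun x hx => Set.indicator_of_notMem hx _)
    (IsLogConcave.indicator hKconv (fun x _ y _ => hwlc x y) fun x _ => hw0 x) hv hvM hvM' a e k he
    hek fun x hx y hy => by
      have h1 : ‖Q x - Q y‖ ≤ Metric.diam K₀ + 2 * ρ := by
        have h2 : ‖x - y‖ ≤ Metric.diam K₀ := by
          rw [← dist_eq_norm]
          exact Metric.dist_le_diam_of_mem hK₀.isBounded (hKsub hx) (hKsub hy)
        have h3 : Q x - Q y = (Q x - x) + (x - y) - (Q y - y) := by abel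
        rw [h3]
        refine (norm_sub_le _ _).trans ?_
        have := norm_add_le (Q x - x) (x - y)
        linarith [(hl hx).1, (hl hy).1]
      have h4 : Q x - Q y = ((x k - y k) / e k) • e := by
        simp only [Q, add_sub_add_left_eq_sub, ← sub_smul]
        congr 1; ring
      rw [h4, norm_smul, he, mul_one, norm_div, Real.norm_eq_abs, Real.norm_eq_abs,
        div_le_iff₀ (abs_pos.2 hek)] at h1
      linarith
  have hind : ∀ φ : EuclideanSpace ℝ (Fin (m + 1)) → ℝ,
      ∫ x, φ x * (K l).indicator w x = ∫ x in K l, φ x * w x := fun φ => by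
    rw [← integral_indicator hKm]
    refine integral_congr_ae (Eventually.of_forall fun x => ?_)
    by_cases hx : x ∈ K l <;> simp [hx]
  rw [hind fun x => |v (Q x) - c| ^ p, hind fun x => ‖fderiv ℝ v (Q x)‖ ^ p] at hneedle
  have hone' := hone (K l) hKsub hKc
  have hvcp : Continuous fun x => |v x - c| ^ p :=
    (hvc.sub continuous_const).abs.rpow_const fun _ => Or.inr hp0.le
  have hvQcp : Continuous fun x => |v (Q x) - c| ^ p := hvcp.comp hQ
  have hin := fun φ hφ => hint φ hφ (K l) hKsub hKc
  have h1 : ∫ x in K l, |v x - c| ^ p * w x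
      ≤ (∫ x in K l, |v (Q x) - c| ^ p * w x) + ε * ∫ x in K l, w x := by
    rw [← integral_const_mul, ← integral_add (hin _ hvQcp) (hone'.const_mul ε)]
    refine setIntegral_mono_on (hin _ hvcp) ((hin _ hvQcp).add (hone'.const_mul ε)) hKm
      fun x hx => ?_
    have hrange : ∀ y, v y - c ∈ Set.Icc (-(2 * M)) (2 * M) := fun y => by
      have h1 := abs_le.1 (hvM y)
      have h2 := abs_le.1 hc
      exact ⟨by linarith, by linarith⟩
    have h3 := hη _ (hrange (Q x)) _ (hrange x)
      (by rw [sub_sub_sub_cancel_right]; exact (hl hx).2.1)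
    nlinarith [(abs_lt.1 h3).1, hw0 x]
  have h2 : ∫ x in K l, ‖fderiv ℝ v (Q x)‖ ^ p * w x
      ≤ (∫ x in K l, ‖fderiv ℝ v x‖ ^ p * w x) + ε * ∫ x in K l, w x := by
    rw [← integral_const_mul, ← integral_add (hin _ hfdp) (hone'.const_mul ε)]
    refine setIntegral_mono_on (hin _ hfdQ) ((hin _ hfdp).add (hone'.const_mul ε)) hKm
      fun x hx => ?_
    nlinarith [(abs_lt.1 (hl hx).2.2).2, hw0 x]
  have h3 : ∫ x in K l, |v x| ^ p * w x ≤ ∫ x in K l, |v x - c| ^ p * w x := by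
    have h4 : ∫ x in K l, (|v x| ^ p * w x - p * c * (|v x| ^ (p - 2) * v x * w x))
        = ∫ x in K l, |v x| ^ p * w x := by
      rw [integral_sub (hin _ hvp) ((hin _ hvp2).const_mul _), integral_const_mul, hKf]
      simp
    rw [← h4]
    refine setIntegral_mono_on ((hin _ hvp).sub ((hin _ hvp2).const_mul _)) (hin _ hvcp) hKm
      fun x hx => ?_
    have h5 := norm_rpow_add_le_norm_add_rpow hp (v x) (-c)
    simp only [Real.norm_eq_abs, ← sub_eq_add_neg, RCLike.inner_apply,
      conj_trivial] at h5
    have h6 : 0 ≤ (2 : ℝ) ^ (2 - p) * |(-c)| ^ p := by positivity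
    have h7 : |v x| ^ p - p * c * (|v x| ^ (p - 2) * v x) ≤ |v x - c| ^ p := by linarith
    have h8 := mul_le_mul_of_nonneg_right h7 (hw0 x)
    linarith
  rw [hsplit _ hKsub hKc] at hKg
  have h4 := mul_le_mul_of_nonneg_left (h3.trans h1) hμ.le
  have h5 : ε * (1 + μ) = δ := div_mul_cancel₀ _ (by positivity)
  rw [← h5] at hKg
  linarith

end WeightedPoincare

section OptimalConstant

/-- The weighted `L^p` Poincaré inequality with log-concave weight on a compact convex set, with
the optimal constant subtracted. -/
theorem exists_setIntegral_abs_sub_rpow_le_fderiv {m : ℕ} (hm : 1 ≤ m) {p μ C M : ℝ}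
    (hp : 2 ≤ p) (hμ : 0 < μ) {K₀ : Set (EuclideanSpace ℝ (Fin (m + 1)))} (hK₀ : IsCompact K₀)
    (hK₀c : Convex ℝ K₀) (hL : μ ^ (1 / p) * Metric.diam K₀ < piP p)
    {w : EuclideanSpace ℝ (Fin (m + 1)) → ℝ} (hw : Measurable w) (hw0 : ∀ x, 0 ≤ w x)
    (hwC : ∀ x, w x ≤ C) (hwlc : IsLogConcave w)
    {v : EuclideanSpace ℝ (Fin (m + 1)) → ℝ} (hv : ContDiff ℝ 1 v) (hvM : ∀ x, |v x| ≤ M)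
    (hvM' : ∀ x, ‖fderiv ℝ v x‖ ≤ M) :
    ∃ c : ℝ, μ * ∫ x in K₀, |v x - c| ^ p * w x ≤ ∫ x in K₀, ‖fderiv ℝ v x‖ ^ p * w x := by
  have hM0 : 0 ≤ M := (abs_nonneg _).trans (hvM 0)
  have hvc : Continuous v := hv.continuous
  have hw1 : IntegrableOn w K₀ := by
    refine IntegrableOn.of_bound hK₀.measure_lt_top hw.aestronglyMeasurable C
      (Eventually.of_forall fun x => ?_)
    rw [Real.norm_of_nonneg (hw0 x)]
    exact hwC x
  let Φ : ℝ → ℝ := fun c => ∫ x in K₀, |v x - c| ^ (p - 2) * (v x - c) * w x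
  have hφ : Continuous fun t : ℝ => |t| ^ (p - 2) * t :=
    (continuous_abs.rpow_const fun _ => Or.inr (by linarith)).mul continuous_id
  have hΦ : ContinuousOn Φ (Set.Icc (-M) M) := by
    obtain ⟨B, hB⟩ := (isCompact_Icc (a := -(2 * M)) (b := 2 * M)).exists_bound_of_continuousOn
      hφ.continuousOn
    refine continuousOn_of_dominated (bound := fun x => B * w x) (fun c _ => ?_) (fun c hc => ?_)
      (hw1.const_mul B) ?_
    · exact ((hφ.comp (hvc.sub continuous_const)).measurable.mul hw).aestronglyMeasurable
    · refine Eventually.of_forall fun x => ?_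
      rw [norm_mul, Real.norm_of_nonneg (hw0 x)]
      refine mul_le_mul_of_nonneg_right (hB _ ?_) (hw0 x)
      have := abs_le.1 (hvM x)
      exact ⟨by linarith [hc.2], by linarith [hc.1]⟩
    · exact Eventually.of_forall fun x =>
        ((hφ.comp (continuous_const.sub continuous_id)).mul continuous_const).continuousOn
  have hlow : Φ M ≤ 0 := integral_nonpos fun x => by
    refine mul_nonpos_of_nonpos_of_nonneg (mul_nonpos_of_nonneg_of_nonpos
      (by positivity) ?_) (hw0 x)
    linarith [(abs_le.1 (hvM x)).2]
  have hhigh : 0 ≤ Φ (-M) := integral_nonneg fun x => by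
    refine mul_nonneg (mul_nonneg (by positivity) ?_) (hw0 x)
    linarith [(abs_le.1 (hvM x)).1]
  obtain ⟨c, hc, hc0⟩ := intermediate_value_Icc' (by linarith) hΦ ⟨hlow, hhigh⟩
  refine ⟨c, ?_⟩
  have hfd : ∀ x, fderiv ℝ (fun x => v x - c) x = fderiv ℝ v x := fun x => fderiv_sub_const c
  have := setIntegral_abs_rpow_le_of_setIntegral_eq_zero hm hp hμ hK₀ hK₀c hL hw hw0 hwC hwlc
    (v := fun x => v x - c) (M := 2 * M) (hv.sub contDiff_const)
    (fun x => by
      refine (abs_sub _ _).trans ?_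
      linarith [hvM x, abs_le.2 hc]) (fun x => by rw [hfd]; linarith [hvM' x]) hc0
  simpa only [hfd] using this

end OptimalConstant

section Mollification

open Convolution in
/-- A compactly supported `C¹` function is approximated in `C¹` by smooth functions with support
arbitrarily close to its own. -/
theorem exists_contDiff_norm_sub_le_of_hasCompactSupport {E : Type*} [NormedAddCommGroup E]
    [InnerProductSpace ℝ E] [FiniteDimensional ℝ E] [MeasurableSpace E] [BorelSpace E]
    {f : E → ℝ} (hf : ContDiff ℝ 1 f) (hfc : HasCompactSupport f) {ε δ : ℝ} (hε : 0 < ε)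
    (hδ : 0 < δ) :
    ∃ g : E → ℝ, ContDiff ℝ (⊤ : ℕ∞) g ∧ tsupport g ⊆ Metric.cthickening δ (tsupport f) ∧
      (∀ x, ‖g x - f x‖ ≤ ε) ∧ ∀ x, ‖fderiv ℝ g x - fderiv ℝ f x‖ ≤ ε := by
  have hfd : Continuous (fderiv ℝ f) := hf.continuous_fderiv one_ne_zero
  obtain ⟨r₁, hr₁, h₁⟩ := Metric.uniformContinuous_iff.1
    (hfc.uniformContinuous_of_continuous hf.continuous) ε hε
  obtain ⟨r₂, hr₂, h₂⟩ := Metric.uniformContinuous_iff.1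
    ((hfc.fderiv ℝ).uniformContinuous_of_continuous hfd) ε hε
  set r := min δ (min r₁ r₂) with hr
  have hr0 : 0 < r := by positivity
  let φ : ContDiffBump (0 : E) := ⟨r / 2, r, by positivity, by linarith⟩
  have hφr : φ.rOut = r := rfl
  refine ⟨φ.normed volume ⋆[ContinuousLinearMap.lsmul ℝ ℝ, volume] f, ?_, ?_, fun x => ?_,
    fun x => ?_⟩
  · exact φ.hasCompactSupport_normed.contDiff_convolution_left _ φ.contDiff_normed
      hf.continuous.locallyIntegrable
  · refine closure_minimal ?_ Metric.isClosed_cthickening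
    refine (support_convolution_subset _).trans ?_
    rintro _ ⟨a, ha, b, hb, rfl⟩
    refine Metric.mem_cthickening_of_dist_le _ b _ _ (subset_tsupport _ hb) ?_
    rw [φ.support_normed_eq, Metric.mem_ball, dist_zero_right, hφr] at ha
    simp only [dist_eq_norm, add_sub_cancel_right]
    exact ha.le.trans (min_le_left _ _)
  · rw [← dist_eq_norm]
    refine φ.dist_normed_convolution_le hf.continuous.aestronglyMeasurable fun y hy => ?_
    refine (h₁ ((Metric.mem_ball.1 hy).trans_le ?_)).le
    exact (min_le_right _ _).trans (min_le_left _ _)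
  · rw [(hfc.hasFDerivAt_convolution_right (ContinuousLinearMap.lsmul ℝ ℝ)
      φ.continuous_normed.locallyIntegrable hf x).fderiv, ← dist_eq_norm]
    have : (φ.normed volume ⋆[(ContinuousLinearMap.lsmul ℝ ℝ).precompR E, volume] fderiv ℝ f) x
        = (φ.normed volume ⋆[ContinuousLinearMap.lsmul ℝ ℝ, volume] fderiv ℝ f) x := by
      refine integral_congr_ae (Eventually.of_forall fun t => ?_)
      ext y
      rfl
    rw [this]
    refine φ.dist_normed_convolution_le hfd.aestronglyMeasurable fun y hy => ?_
    refine (h₂ ((Metric.mem_ball.1 hy).trans_le ?_)).le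
    exact (min_le_right _ _).trans (min_le_right _ _)

end Mollification

section WeakFormulation

theorem norm_gradient_eq_norm_fderiv {E : Type*} [NormedAddCommGroup E] [InnerProductSpace ℝ E]
    [CompleteSpace E] (f : E → ℝ) (x : E) : ‖gradient f x‖ = ‖fderiv ℝ f x‖ :=
  LinearIsometryEquiv.norm_map _ _

theorem real_inner_gradient_right {E : Type*} [NormedAddCommGroup E] [InnerProductSpace ℝ E]
    [CompleteSpace E] (f : E → ℝ) (x y : E) : ⟪y, gradient f x⟫ = fderiv ℝ f x y := by
  rw [real_inner_comm, gradient, InnerProductSpace.toDual_symm_apply]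

/-- A weak formulation with continuous data, tested against smooth functions, extends to
compactly supported `C¹` test functions. -/
theorem setIntegral_inner_gradient_eq_of_contDiff {E : Type*} [NormedAddCommGroup E]
    [InnerProductSpace ℝ E] [FiniteDimensional ℝ E] [MeasurableSpace E] [BorelSpace E]
    {Ω : Set E} (hΩ : IsOpen Ω) {A : E → E} {B : E → ℝ} (hA : ContinuousOn A Ω)
    (hB : ContinuousOn B Ω)
    (h : ∀ φ : E → ℝ, ContDiff ℝ (⊤ : ℕ∞) φ → HasCompactSupport φ → tsupport φ ⊆ Ω →
      ∫ x in Ω, ⟪A x, gradient φ x⟫ = ∫ x in Ω, B x * φ x)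
    {φ : E → ℝ} (hφ : ContDiff ℝ 1 φ) (hφc : HasCompactSupport φ) (hφΩ : tsupport φ ⊆ Ω) :
    ∫ x in Ω, ⟪A x, gradient φ x⟫ = ∫ x in Ω, B x * φ x := by
  obtain ⟨δ, hδ, hδΩ⟩ := hφc.isCompact.exists_cthickening_subset_open hΩ hφΩ
  have hK : IsCompact (Metric.cthickening δ (tsupport φ)) := hφc.isCompact.cthickening
  choose g hg hgK hgφ hgφ' using fun k : ℕ =>
    exists_contDiff_norm_sub_le_of_hasCompactSupport hφ hφc (Nat.one_div_pos_of_nat (α := ℝ)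
      (n := k)) hδ
  set K := Metric.cthickening δ (tsupport φ)
  obtain ⟨a, ha⟩ := hK.exists_bound_of_continuousOn (hA.mono hδΩ)
  obtain ⟨b, hb⟩ := hK.exists_bound_of_continuousOn (hB.mono hδΩ)
  have hφ' : Continuous (fderiv ℝ φ) := hφ.continuous_fderiv one_ne_zero
  obtain ⟨M, hM⟩ := hφc.exists_bound_of_continuous hφ.continuous
  obtain ⟨M', hM'⟩ := (hφc.fderiv ℝ).exists_bound_of_continuous hφ'
  have hone : ∀ k : ℕ, 1 / ((k : ℝ) + 1) ≤ 1 := fun k => by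
    rw [div_le_one (by positivity)]
    linarith [k.cast_nonneg (α := ℝ)]
  have hlim : Tendsto (fun k : ℕ => 1 / ((k : ℝ) + 1)) atTop (nhds 0) :=
    tendsto_one_div_add_atTop_nhds_zero_nat
  have hl : ∀ x, Tendsto (fun k => g k x) atTop (nhds (φ x)) := fun x =>
    tendsto_iff_norm_sub_tendsto_zero.2
      (squeeze_zero (fun _ => norm_nonneg _) (fun k => hgφ k x) hlim)
  have hl' : ∀ x, Tendsto (fun k => fderiv ℝ (g k) x) atTop (nhds (fderiv ℝ φ x)) := fun x =>
    tendsto_iff_norm_sub_tendsto_zero.2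
      (squeeze_zero (fun _ => norm_nonneg _) (fun k => hgφ' k x) hlim)
  have hKi : ∀ c : ℝ, Integrable (K.indicator fun _ => c) (volume.restrict Ω) := fun c =>
    ((integrable_indicator_iff hK.measurableSet).2
      (continuousOn_const.integrableOn_compact hK)).integrableOn
  simp only [real_inner_gradient_right] at h ⊢
  refine tendsto_nhds_unique (f := fun k => ∫ x in Ω, fderiv ℝ (g k) x (A x)) (l := atTop)
    ?_ ?_
  · refine tendsto_integral_of_dominated_convergence _ (fun k => ?_) (hKi ((M' + 1) * a))
      (fun k => Eventually.of_forall fun x => ?_) (Eventually.of_forall fun x => ?_)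
    · exact ((((hg k).continuous_fderiv (by simp)).continuousOn).clm_apply hA
        ).aestronglyMeasurable hΩ.measurableSet
    · by_cases hx : x ∈ K
      · rw [Set.indicator_of_mem hx]
        have h1 : ‖fderiv ℝ (g k) x‖ ≤ M' + 1 := by
          have := norm_le_norm_add_norm_sub' (fderiv ℝ (g k) x) (fderiv ℝ φ x)
          linarith [hM' x, (hgφ' k x).trans (hone k)]
        exact (ContinuousLinearMap.le_opNorm _ _).trans
          (mul_le_mul h1 (ha x hx) (norm_nonneg _) ((norm_nonneg _).trans h1))
      · rw [Set.indicator_of_notMem hx, fderiv_of_notMem_tsupport ℝ fun h => hx (hgK k h)]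
        simp
    · exact ((ContinuousLinearMap.apply ℝ ℝ (A x)).continuous.tendsto _).comp (hl' x)
  · have : (fun k => ∫ x in Ω, fderiv ℝ (g k) x (A x)) = fun k => ∫ x in Ω, B x * g k x := by
      ext k
      exact h (g k) (hg k) (hK.of_isClosed_subset (isClosed_tsupport _) (hgK k))
        ((hgK k).trans hδΩ)
    rw [this]
    refine tendsto_integral_of_dominated_convergence _ (fun k => ?_) (hKi (b * (M + 1)))
      (fun k => Eventually.of_forall fun x => ?_) (Eventually.of_forall fun x => ?_)
    · exact (hB.mul (hg k).continuous.continuousOn).aestronglyMeasurable hΩ.measurableSet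
    · by_cases hx : x ∈ K
      · rw [Set.indicator_of_mem hx, norm_mul]
        have h1 : ‖g k x‖ ≤ M + 1 := by
          have := norm_le_norm_add_norm_sub' (g k x) (φ x)
          linarith [hM x, (hgφ k x).trans (hone k)]
        exact mul_le_mul (hb x hx) h1 (norm_nonneg _) ((norm_nonneg _).trans (hb x hx))
      · rw [Set.indicator_of_notMem hx, image_eq_zero_of_notMem_tsupport fun h => hx (hgK k h)]
        simp
    · exact tendsto_const_nhds.mul (hl x)

end WeakFormulation

section Picone

theorem integrableOn_of_eq_zero_of_notMem_isCompact {E F : Type*} [TopologicalSpace E]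
    [T2Space E] [MeasurableSpace E] [BorelSpace E] [NormedAddCommGroup F] {μ : Measure E}
    [IsFiniteMeasureOnCompacts μ] [SecondCountableTopologyEither E F]
    {Ω K : Set E} (hΩ : IsOpen Ω) (hK : IsCompact K) (hKΩ : K ⊆ Ω) {f : E → F}
    (hf : ContinuousOn f Ω) (hf0 : ∀ x ∉ K, f x = 0) : IntegrableOn f Ω μ :=
  ((hf.mono hKΩ).integrableOn_compact hK).of_forall_sdiff_eq_zero hΩ.measurableSet
    fun x hx => hf0 x hx.2

/-- Picone's inequality with remainder, in integrated form. -/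
theorem exists_two_rpow_mul_setIntegral_le {E : Type*} [NormedAddCommGroup E]
    [InnerProductSpace ℝ E] [FiniteDimensional ℝ E] [MeasurableSpace E] [BorelSpace E]
    {p Λ : ℝ} (hp : 2 ≤ p) {Ω : Set E} (hΩ : IsOpen Ω) {u₁ : E → ℝ} (hu₁C : ContDiffOn ℝ 1 u₁ Ω)
    (hu₁pos : ∀ x ∈ Ω, 0 < u₁ x)
    (hu₁eig : ∀ φ : E → ℝ, ContDiff ℝ (⊤ : ℕ∞) φ → HasCompactSupport φ → tsupport φ ⊆ Ω →
      ∫ x in Ω, ‖gradient u₁ x‖ ^ (p - 2) * ⟪gradient u₁ x, gradient φ x⟫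
        = Λ * ∫ x in Ω, |u₁ x| ^ (p - 2) * u₁ x * φ x)
    {u : E → ℝ} (hu : ContDiff ℝ 1 u) (huK : HasCompactSupport u) (huS : tsupport u ⊆ Ω) :
    ∃ v : E → ℝ, ContDiff ℝ 1 v ∧ HasCompactSupport v ∧ (∀ x ∈ Ω, u x = v x * u₁ x) ∧
      (2 : ℝ) ^ (2 - p) * ∫ x in Ω, ‖fderiv ℝ v x‖ ^ p * u₁ x ^ p
        ≤ (∫ x in Ω, ‖gradient u x‖ ^ p) - Λ * ∫ x in Ω, |u x| ^ p := by
  have hp0 : 0 < p := by linarith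
  have hK : IsCompact (tsupport u) := huK
  have huz : ∀ x ∉ tsupport u, u x = 0 := fun x => image_eq_zero_of_notMem_tsupport
  let v : E → ℝ := fun x => u x / u₁ x
  have huv : ∀ x ∈ Ω, u x = v x * u₁ x := fun x hx => (div_mul_cancel₀ _ (hu₁pos x hx).ne').symm
  have hu₁A : ∀ x ∈ Ω, ContDiffAt ℝ 1 u₁ x := fun x hx => hu₁C.contDiffAt (hΩ.mem_nhds hx)
  have hglue : ∀ f : E → ℝ, (∀ x ∈ Ω, ContDiffAt ℝ 1 f x) → (∀ x, u x = 0 → f x = 0) →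
      ContDiff ℝ 1 f := fun f hf hf0 => contDiff_iff_contDiffAt.2 fun x => by
    by_cases hx : x ∈ tsupport u
    · exact hf x (huS hx)
    · exact contDiffAt_const.congr_of_eventuallyEq
        (((notMem_tsupport_iff_eventuallyEq.1 hx)).mono fun y hy => hf0 y hy)
  have htsupp : ∀ f : E → ℝ, (∀ x, u x = 0 → f x = 0) → tsupport f ⊆ tsupport u := fun f hf =>
    closure_mono fun x hx h => hx (hf x h)
  have hv0 : ∀ x, u x = 0 → v x = 0 := fun x hx => by simp [v, hx]
  have hv : ContDiff ℝ 1 v := hglue v (fun x hx => hu.contDiffAt.div (hu₁A x hx)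
    (hu₁pos x hx).ne') hv0
  let φ : E → ℝ := fun x => |v x| ^ p * u₁ x
  have hφ0 : ∀ x, u x = 0 → φ x = 0 := fun x hx => by simp [φ, hv0 x hx, hp0.ne']
  have habs : ContDiff ℝ 1 fun t : ℝ => |t| ^ p := contDiff_norm_rpow (by linarith)
  have hφ : ContDiff ℝ 1 φ := hglue φ (fun x hx => (habs.comp hv).contDiffAt.mul (hu₁A x hx)) hφ0
  have hvK : HasCompactSupport v := hK.of_isClosed_subset (isClosed_tsupport _) (htsupp v hv0)
  have hφK : HasCompactSupport φ := hK.of_isClosed_subset (isClosed_tsupport _) (htsupp φ hφ0)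
  have hφS := (htsupp φ hφ0).trans huS
  refine ⟨v, hv, hvK, huv, ?_⟩
  have hgu : ∀ x ∈ Ω, gradient u x = v x • gradient u₁ x + u₁ x • gradient v x := fun x hx => by
    have h1 : HasFDerivAt u (v x • fderiv ℝ u₁ x + u₁ x • fderiv ℝ v x) x :=
      ((hv.differentiable one_ne_zero x).hasFDerivAt.mul
        ((hu₁A x hx).differentiableAt one_ne_zero).hasFDerivAt).congr_of_eventuallyEq
        (Filter.mem_of_superset (hΩ.mem_nhds hx) huv)
    simp [gradient, h1.fderiv]
  have hgφ : ∀ x ∈ Ω, gradient φ x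
      = |v x| ^ p • gradient u₁ x + (u₁ x * (p * |v x| ^ (p - 2) * v x)) • gradient v x :=
    fun x hx => by
      have h1 := ((hasDerivAt_abs_rpow (v x) (by linarith : 1 < p)).comp_hasFDerivAt x
        (hv.differentiable one_ne_zero x).hasFDerivAt).mul
        ((hu₁A x hx).differentiableAt one_ne_zero).hasFDerivAt
      have h2 : fderiv ℝ φ x = _ := h1.fderiv
      simp [gradient, h2, mul_smul]
  have hpt : ∀ x ∈ Ω, ‖gradient u₁ x‖ ^ (p - 2) * ⟪gradient u₁ x, gradient φ x⟫
      + (2 : ℝ) ^ (2 - p) * (‖fderiv ℝ v x‖ ^ p * u₁ x ^ p) ≤ ‖gradient u x‖ ^ p := fun x hx => by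
    have h1 := norm_rpow_add_le_norm_add_rpow hp (v x • gradient u₁ x) (u₁ x • gradient v x)
    rw [← hgu x hx] at h1
    refine le_trans (le_of_eq ?_) h1
    have hpos := hu₁pos x hx
    rw [hgφ x hx, norm_smul, norm_smul, Real.norm_eq_abs, Real.norm_eq_abs, abs_of_pos hpos,
      Real.mul_rpow (abs_nonneg _) (norm_nonneg _), Real.mul_rpow (abs_nonneg _) (norm_nonneg _),
      Real.mul_rpow hpos.le (norm_nonneg _), norm_gradient_eq_norm_fderiv v,
      inner_add_right, inner_smul_left, inner_smul_right, inner_smul_right, inner_smul_right,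
      real_inner_self_eq_norm_sq, conj_trivial]
    have h2 := rpow_sub_two_mul_sq (norm_nonneg (gradient u₁ x)) hp0.ne'
    rw [← h2]
    ring
  have hgc : ∀ {f : E → ℝ}, ContDiff ℝ 1 f → Continuous (gradient f) := fun hf =>
    (LinearIsometryEquiv.continuous _).comp (hf.continuous_fderiv one_ne_zero)
  have hgu₁ : ContinuousOn (gradient u₁) Ω :=
    (LinearIsometryEquiv.continuous _).comp_continuousOn
      (hu₁C.continuousOn_fderiv_of_isOpen hΩ le_rfl)
  have hgz : ∀ f : E → ℝ, (∀ x, u x = 0 → f x = 0) → ∀ x ∉ tsupport u, fderiv ℝ f x = 0 :=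
    fun f hf x hx => fderiv_of_notMem_tsupport ℝ fun h => hx (htsupp f hf h)
  have hgz' : ∀ f : E → ℝ, (∀ x, u x = 0 → f x = 0) → ∀ x ∉ tsupport u, gradient f x = 0 :=
    fun f hf x hx => by simp [gradient, hgz f hf x hx]
  have hA : ContinuousOn (fun x => ‖gradient u₁ x‖ ^ (p - 2)) Ω :=
    hgu₁.norm.rpow_const fun _ _ => Or.inr (by linarith)
  have hB : ContinuousOn (fun x => |u₁ x| ^ (p - 2) * u₁ x) Ω :=
    (hu₁C.continuousOn.abs.rpow_const fun _ _ => Or.inr (by linarith)).mul hu₁C.continuousOn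
  have hweak := setIntegral_inner_gradient_eq_of_contDiff hΩ
    (A := fun x => ‖gradient u₁ x‖ ^ (p - 2) • gradient u₁ x)
    (B := fun x => Λ * (|u₁ x| ^ (p - 2) * u₁ x)) (hA.smul hgu₁) (continuousOn_const.mul hB)
    (fun ψ h1 h2 h3 => by
      simpa only [inner_smul_left, conj_trivial, mul_assoc, integral_const_mul]
        using hu₁eig ψ h1 h2 h3) hφ hφK hφS
  simp only [inner_smul_left, conj_trivial] at hweak
  have hright : ∫ x in Ω, Λ * (|u₁ x| ^ (p - 2) * u₁ x) * φ x = Λ * ∫ x in Ω, |u x| ^ p := by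
    rw [← integral_const_mul]
    refine setIntegral_congr_fun hΩ.measurableSet fun x hx => ?_
    have hpos := hu₁pos x hx
    simp only [φ]
    rw [huv x hx, abs_mul, Real.mul_rpow (abs_nonneg _) (abs_nonneg _), abs_of_pos hpos,
      ← rpow_sub_two_mul_sq hpos.le hp0.ne']
    ring
  rw [hright] at hweak
  have hint : ∀ f : E → ℝ, ContinuousOn f Ω → (∀ x ∉ tsupport u, f x = 0) → IntegrableOn f Ω :=
    fun f => integrableOn_of_eq_zero_of_notMem_isCompact hΩ hK huS
  have hi1 := hint (fun x => ‖gradient u₁ x‖ ^ (p - 2) * ⟪gradient u₁ x, gradient φ x⟫)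
    (hA.mul (hgu₁.inner (hgc hφ).continuousOn)) fun x hx => by simp [hgz' φ hφ0 x hx]
  have hi2 := hint (fun x => (2 : ℝ) ^ (2 - p) * (‖fderiv ℝ v x‖ ^ p * u₁ x ^ p))
    (continuousOn_const.mul (((hv.continuous_fderiv one_ne_zero).continuousOn.norm.rpow_const
      fun _ _ => Or.inr hp0.le).mul (hu₁C.continuousOn.rpow_const fun _ _ => Or.inr hp0.le)))
    fun x hx => by simp [hgz v hv0 x hx, hp0.ne']
  have hi3 := hint (fun x => ‖gradient u x‖ ^ p)
    ((hgc hu).norm.rpow_const fun _ => Or.inr hp0.le).continuousOn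
    fun x hx => by simp [hgz' u (fun _ h => h) x hx, hp0.ne']
  rw [← hweak, le_sub_iff_add_le, add_comm, ← integral_const_mul, ← integral_add hi1 hi2]
  exact setIntegral_mono_on (hi1.add hi2) hi3 hΩ.measurableSet hpt

end Picone

section Stability

/-- The power of a positive function with concave logarithm is log-concave. -/
theorem isLogConcave_indicator_rpow {E : Type*} [AddCommGroup E] [Module ℝ E] {Ω : Set E}
    {f : E → ℝ} (hf : ∀ x ∈ Ω, 0 < f x) (hlc : ConcaveOn ℝ Ω fun x => Real.log (f x)) {p : ℝ}
    (hp : 0 ≤ p) : IsLogConcave (Ω.indicator fun x => f x ^ p) := by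
  refine IsLogConcave.indicator hlc.1 (fun x hx y hy t ht ht1 => ?_)
    fun x hx => Real.rpow_nonneg (hf x hx).le _
  have hz := hf _ (hlc.1 hx hy ht.le (sub_nonneg.2 ht1.le) (add_sub_cancel _ _))
  have h1 := hlc.2 hx hy ht.le (sub_nonneg.2 ht1.le) (add_sub_cancel _ _)
  simp only [smul_eq_mul] at h1
  rw [Real.rpow_def_of_pos (hf x hx), Real.rpow_def_of_pos (hf y hy), Real.rpow_def_of_pos hz,
    ← Real.exp_mul, ← Real.exp_mul, ← Real.exp_add, Real.exp_le_exp]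
  nlinarith [mul_le_mul_of_nonneg_left h1 hp]

theorem piP_pos {p : ℝ} (hp : 1 < p) : 0 < piP p := by
  have h0 : 0 < p := by linarith
  have h1 : 0 < Real.sin (Real.pi / p) := Real.sin_pos_of_pos_of_lt_pi (by positivity)
    ((div_lt_iff₀ h0).2 (by nlinarith [Real.pi_pos]))
  have h2 : 0 < (p - 1) ^ (1 / p) := Real.rpow_pos_of_pos (by linarith) _
  unfold piP
  positivity

end Stability

/-- Stability of the `L^p`-Poincaré inequality on bounded convex domains, with explicit
geometric constant `2^{2-p} (π_p / diam Ω)^p`.  The first eigenfunction `u₁` is positive in `Ω`,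
`C¹` in `Ω`, continuous up to and vanishing on the boundary, a weak solution of the eigenvalue
equation, and (by Sakaguchi's theorem, valid on bounded convex domains with smooth boundary)
`log u₁` is concave. -/
theorem stability_Lp_poincare
    {n : ℕ} (hn : 2 ≤ n) {p : ℝ} (hp : 2 ≤ p)
    {Ω : Set (EuclideanSpace ℝ (Fin n))}
    (hΩo : IsOpen Ω) (hΩb : Bornology.IsBounded Ω) (hΩc : Convex ℝ Ω)
    (u₁ : EuclideanSpace ℝ (Fin n) → ℝ)
    (hu₁C : ContDiffOn ℝ 1 u₁ Ω)
    (hu₁pos : ∀ x ∈ Ω, 0 < u₁ x)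
    (hu₁cont : ContinuousOn u₁ (closure Ω))
    (hu₁bd : ∀ x ∈ frontier Ω, u₁ x = 0)
    (hu₁eig : ∀ φ : EuclideanSpace ℝ (Fin n) → ℝ,
      ContDiff ℝ (⊤ : ℕ∞) φ → HasCompactSupport φ → tsupport φ ⊆ Ω →
      ∫ x in Ω, ‖gradient u₁ x‖ ^ (p - 2) * ⟪gradient u₁ x, gradient φ x⟫
        = lambda1 n p Ω * ∫ x in Ω, |u₁ x| ^ (p - 2) * u₁ x * φ x)
    (hu₁lc : ConcaveOn ℝ Ω fun x => Real.log (u₁ x))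
    (u : EuclideanSpace ℝ (Fin n) → ℝ)
    (huC : ContDiff ℝ (⊤ : ℕ∞) u) (huK : HasCompactSupport u) (huS : tsupport u ⊆ Ω) :
    (∫ x in Ω, ‖gradient u x‖ ^ p) - lambda1 n p Ω * ∫ x in Ω, |u x| ^ p
      ≥ (2 : ℝ) ^ (2 - p) * (piP p / Metric.diam Ω) ^ p *
        ⨅ c : ℝ, ∫ x in Ω, |u x - c * u₁ x| ^ p := by
  obtain ⟨m, rfl⟩ : ∃ m, n = m + 1 := ⟨n - 1, by omega⟩
  have hp0 : 0 < p := by linarith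
  obtain ⟨v, hv, hvK, huv, hpic⟩ := exists_two_rpow_mul_setIntegral_le hp hΩo hu₁C hu₁pos hu₁eig
    (huC.of_le (by exact_mod_cast le_top)) huK huS
  refine ge_iff_le.2 (le_trans ?_ hpic)
  rw [mul_assoc]
  refine mul_le_mul_of_nonneg_left ?_ (by positivity)
  set I := ⨅ c : ℝ, ∫ x in Ω, |u x - c * u₁ x| ^ p with hI
  have hrhs : 0 ≤ ∫ x in Ω, ‖fderiv ℝ v x‖ ^ p * u₁ x ^ p :=
    setIntegral_nonneg hΩo.measurableSet fun x hx =>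
      mul_nonneg (by positivity) (Real.rpow_nonneg (hu₁pos x hx).le _)
  have hIle : ∀ c : ℝ, I ≤ ∫ x in Ω, |u x - c * u₁ x| ^ p := fun c =>
    ciInf_le ⟨0, by rintro _ ⟨c, rfl⟩; exact integral_nonneg fun x => by positivity⟩ c
  have hI0 : 0 ≤ I := le_ciInf fun c => integral_nonneg fun x => by positivity
  rcases (Metric.diam_nonneg (s := Ω)).eq_or_lt' with hd | hd
  · rw [hd, div_zero, Real.zero_rpow hp0.ne', zero_mul]
    exact hrhs
  obtain ⟨C, hC⟩ := hΩb.isCompact_closure.exists_bound_of_continuousOn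
    (hu₁cont.rpow_const fun _ _ => Or.inr hp0.le)
  obtain ⟨M, hM⟩ := hvK.exists_bound_of_continuous hv.continuous
  obtain ⟨M', hM'⟩ := (hvK.fderiv ℝ).exists_bound_of_continuous
    (hv.continuous_fderiv one_ne_zero)
  have hC0 : ∀ x ∈ Ω, u₁ x ^ p ≤ C := fun x hx => (le_abs_self _).trans (hC x (subset_closure hx))
  have hwm : Measurable (Ω.indicator fun x => u₁ x ^ p) := by
    classical
    rw [← Set.piecewise_eq_indicator]
    exact (hu₁C.continuousOn.rpow_const fun _ _ => Or.inr hp0.le).measurable_piecewise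
      continuousOn_const hΩo.measurableSet
  have hw0 : ∀ x, 0 ≤ Ω.indicator (fun x => u₁ x ^ p) x :=
    Set.indicator_nonneg fun x hx => Real.rpow_nonneg (hu₁pos x hx).le _
  have hset : ∀ f : EuclideanSpace ℝ (Fin (m + 1)) → ℝ,
      ∫ x in closure Ω, f x * Ω.indicator (fun x => u₁ x ^ p) x = ∫ x in Ω, f x * u₁ x ^ p :=
    fun f => by
      simp_rw [← Set.indicator_mul_right]
      rw [setIntegral_indicator hΩo.measurableSet, Set.inter_eq_right.2 subset_closure]
  have hkey : ∀ μ : ℝ, 0 < μ → μ < (piP p / Metric.diam Ω) ^ p →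
      μ * I ≤ ∫ x in Ω, ‖fderiv ℝ v x‖ ^ p * u₁ x ^ p := fun μ hμ hlt => by
    have hL : μ ^ (1 / p) * Metric.diam (closure Ω) < piP p := by
      rw [Metric.diam_closure, ← lt_div_iff₀ hd, one_div]
      exact (Real.rpow_inv_lt_iff_of_pos hμ.le (div_pos (piP_pos (by linarith)) hd).le hp0).2 hlt
    obtain ⟨c, hc⟩ := exists_setIntegral_abs_sub_rpow_le_fderiv (by omega) hp hμ
      hΩb.isCompact_closure hΩc.closure hL hwm hw0
      (C := max C 0) (Set.indicator_le' (fun x hx => (hC0 x hx).trans (le_max_left _ _))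
        fun x _ => le_max_right _ _) (isLogConcave_indicator_rpow hu₁pos hu₁lc hp0.le) hv
      (M := max M M') (fun x => (hM x).trans (le_max_left _ _))
      fun x => (hM' x).trans (le_max_right _ _)
    rw [hset fun x => |v x - c| ^ p, hset fun x => ‖fderiv ℝ v x‖ ^ p] at hc
    refine le_trans (mul_le_mul_of_nonneg_left ((hIle c).trans_eq ?_) hμ.le) hc
    refine setIntegral_congr_fun hΩo.measurableSet fun x hx => ?_
    rw [huv x hx, ← sub_mul, abs_mul, Real.mul_rpow (abs_nonneg _) (abs_nonneg _),
      abs_of_pos (hu₁pos x hx)]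
  have hμ0 : 0 < (piP p / Metric.diam Ω) ^ p :=
    Real.rpow_pos_of_pos (div_pos (piP_pos (by linarith)) hd) _
  have hlim : Tendsto (fun μ => μ * I) (nhdsWithin ((piP p / Metric.diam Ω) ^ p)
      (Set.Iio ((piP p / Metric.diam Ω) ^ p))) (nhds ((piP p / Metric.diam Ω) ^ p * I)) :=
    ((continuous_id.mul continuous_const).tendsto _).mono_left nhdsWithin_le_nhds
  refine le_of_tendsto hlim ?_
  filter_upwards [Ioo_mem_nhdsLT hμ0] with μ hμ using hkey μ hμ.1 hμ.2
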